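/- arXiv:2310.15918 — 3 statements merged into one kernel-verified Lean document; each statement's English description precedes it below -/
import Mathlib

section
/- Assume the Riemann Hypothesis. For all real α with 0 < α < 1/2 and all real x > 1 that are not integers, one has f_α(x) − M_α(x) = (1/(2π)) · lim_{U→∞} ∫_{−U}^{U} −(ζ'/ζ)(1/2 + α + it) · ζ(1/2 + it) · x^{1/2 + α + it}/(1/2 + α + it) dt, where the limit of the symmetric truncated integrals exists. -/
open Complex Real MeasureTheory

/-- The logarithmic derivative ζ'/ζ of the Riemann zeta function. -/
noncomputable def logDerivZeta (s : ℂ) : ℂ := deriv riemannZeta s / riemannZeta s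

/-- `f_α(x) = Σ_{m·d ≤ x} Λ(m) d^α`, the summatory function of `Λ * τ_{-α}`
(equal to `0` for `x < 1`). -/
noncomputable def fAlpha (α x : ℝ) : ℝ :=
  ∑ n ∈ Finset.Icc 1 ⌊x⌋₊, ∑ d ∈ n.divisors,
    ArithmeticFunction.vonMangoldt (n / d) * (d : ℝ) ^ α

/-- `M_α(x) = (-1/(1+α)) (ζ'/ζ)(1+α) x^{1+α} + ζ(1-α) x` (both zeta values are real). -/
noncomputable def MAlpha (α x : ℝ) : ℝ :=
  (-(1/(1+α)) * (logDerivZeta ((1:ℂ) + (α:ℂ)))).re * x ^ (1+α)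
    + (riemannZeta ((1:ℂ) - (α:ℂ))).re * x

open Filter Topology Set

/-- Differences of symmetric vertical integrals tend to zero when the horizontal sides of the
rectangles do. -/
lemma tendsto_vertical_integral_sub_of_decay {g : ℂ → ℂ} {a b : ℝ} (hab : a ≤ b)
    (hg : ∀ s : ℂ, a ≤ s.re → s.re ≤ b → DifferentiableAt ℂ g s) {B : ℝ → ℝ}
    (hB : Tendsto B atTop (𝓝 0))
    (hgB : ∀ σ t : ℝ, a ≤ σ → σ ≤ b → 1 ≤ |t| → ‖g (σ + t * I)‖ ≤ B |t|) :
    Tendsto (fun U : ℝ => (∫ t in (-U)..U, g (b + t * I)) - ∫ t in (-U)..U, g (a + t * I))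
      atTop (𝓝 0) := by
  refine squeeze_zero_norm' (a := fun U => 2 * (b - a) * B U) ?_
    (by simpa using hB.const_mul (2 * (b - a)))
  filter_upwards [eventually_ge_atTop 1] with U hU
  have key := integral_boundary_rect_eq_zero_of_differentiableOn g (a + (-U : ℝ) * I) (b + U * I)
    (fun s hs => by
      rw [Complex.mem_reProdIm] at hs
      simp only [add_re, ofReal_re, mul_re, I_re, mul_zero, ofReal_im, I_im, mul_one, sub_self,
        add_zero, uIcc_of_le hab] at hs
      exact (hg s hs.1.1 hs.1.2).differentiableWithinAt)
  simp only [add_re, ofReal_re, mul_re, I_re, mul_zero, ofReal_im, I_im, mul_one, sub_self,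
        add_zero, add_im, mul_im, zero_add] at key
  have hor : ∀ t : ℝ, |t| = U → ‖∫ σ in a..b, g (σ + t * I)‖ ≤ (b - a) * B U := fun t ht => by
    have := intervalIntegral.norm_integral_le_of_norm_le_const (a := a) (b := b)
      (f := fun σ : ℝ => g (σ + t * I)) (C := B U) (fun σ hσ => by
        rw [uIoc_of_le hab] at hσ
        exact ht ▸ hgB σ t hσ.1.le hσ.2 (ht ▸ hU))
    rwa [abs_of_nonneg (sub_nonneg.2 hab), mul_comm (B U)] at this
  have h1 := hor (-U) (by rw [abs_neg, abs_of_nonneg (by linarith)])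
  have h2 := hor U (abs_of_nonneg (by linarith))
  calc _ = ‖I • ((∫ t in (-U)..U, g (b + t * I)) - ∫ t in (-U)..U, g (a + t * I))‖ := by
        rw [norm_smul, norm_I, one_mul]
    _ = ‖(∫ σ in a..b, g (σ + U * I)) - ∫ σ in a..b, g (σ + (-U : ℝ) * I)‖ := by
        congr 1; rw [smul_sub]; linear_combination key
    _ ≤ _ := (norm_sub_le _ _).trans (by linarith)

lemma add_mul_I_ne_zero {b t : ℝ} (hb : b ≠ 0) : (b : ℂ) + t * I ≠ 0 := fun h => hb (by
  simpa using congrArg Complex.re h)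

lemma continuous_inv_add_mul_I {b : ℝ} (hb : b ≠ 0) :
    Continuous fun t : ℝ => ((b : ℂ) + t * I)⁻¹ :=
  Continuous.inv₀ (by fun_prop) fun _ => add_mul_I_ne_zero hb

lemma integral_inv_add_mul_I_neg (b U : ℝ) :
    ∫ t in (-U)..U, (((-b : ℝ) : ℂ) + t * I)⁻¹ = -∫ t in (-U)..U, ((b : ℂ) + t * I)⁻¹ := by
  have := intervalIntegral.integral_comp_neg (a := -U) (b := U)
    (fun t : ℝ => (((-b : ℝ) : ℂ) + t * I)⁻¹)
  rw [neg_neg] at this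
  rw [← this, ← intervalIntegral.integral_neg]
  congr 1; ext t
  rw [← inv_neg]; congr 1; push_cast; ring

lemma tendsto_integral_inv_add_mul_I {b : ℝ} (hb : 0 < b) :
    Tendsto (fun U : ℝ => ∫ t in (-U)..U, ((b : ℂ) + t * I)⁻¹) atTop (𝓝 (π : ℂ)) := by
  have h : ∀ U : ℝ, ∫ t in (-U)..U, ((b : ℂ) + t * I)⁻¹ = ((2 * Real.arctan (U / b) : ℝ) : ℂ) := by
    intro U
    have hi : ∀ c d : ℝ, IntervalIntegrable (fun t : ℝ => ((b : ℂ) + t * I)⁻¹) volume c d :=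
      fun c d => (continuous_inv_add_mul_I hb.ne').intervalIntegrable c d
    have hflip := intervalIntegral.integral_comp_neg (a := -U) (b := U)
      (fun t : ℝ => ((b : ℂ) + t * I)⁻¹)
    rw [neg_neg] at hflip
    have hi' : IntervalIntegrable (fun t : ℝ => ((b : ℂ) + (-t : ℝ) * I)⁻¹) volume (-U) U :=
      ((continuous_inv_add_mul_I hb.ne').comp continuous_neg).intervalIntegrable _ _
    have hsum : (∫ t in (-U)..U, ((b : ℂ) + t * I)⁻¹) + ∫ t in (-U)..U, ((b : ℂ) + t * I)⁻¹
        = ((4 * Real.arctan (U / b) : ℝ) : ℂ) := by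
      nth_rw 2 [← hflip]
      rw [← intervalIntegral.integral_add (hi _ _) hi']
      have : ∀ t : ℝ, ((b : ℂ) + t * I)⁻¹ + ((b : ℂ) + (-t : ℝ) * I)⁻¹
          = ((2 * b⁻¹ * (1 + (b⁻¹ * t) ^ 2)⁻¹ : ℝ) : ℂ) := by
        intro t
        have h1 := add_mul_I_ne_zero (t := t) hb.ne'
        have h2 := add_mul_I_ne_zero (t := -t) hb.ne'
        have hbc : (b : ℂ) ≠ 0 := by exact_mod_cast hb.ne'
        have h3 : (b : ℂ) ^ 2 + t ^ 2 ≠ 0 := by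
          exact_mod_cast (by positivity : (b ^ 2 + t ^ 2 : ℝ) ≠ 0)
        have h4 : ((b : ℂ) + t * I) * ((b : ℂ) + (-t : ℝ) * I) = (b : ℂ) ^ 2 + t ^ 2 := by
          push_cast; linear_combination (-(t : ℂ) ^ 2) * I_sq
        have h5 : (1 + ((b : ℂ)⁻¹ * t) ^ 2) = ((b : ℂ) ^ 2 + t ^ 2) / b ^ 2 := by
          field_simp
        rw [inv_add_inv h1 h2, h4]
        push_cast
        rw [h5]
        field_simp
        ring
      simp_rw [this]
      rw [intervalIntegral.integral_ofReal]
      congr 1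
      rw [intervalIntegral.integral_const_mul,
        intervalIntegral.integral_comp_mul_left (fun t => (1 + t ^ 2)⁻¹) (inv_ne_zero hb.ne'),
        integral_inv_one_add_sq, smul_eq_mul, mul_neg, Real.arctan_neg,
        show b⁻¹ * U = U / b by ring]
      field_simp
      ring
    push_cast at hsum ⊢
    linear_combination hsum / 2
  simp_rw [h]
  refine (continuous_ofReal.tendsto π).comp ?_
  have := (Real.tendsto_arctan_atTop.mono_right nhdsWithin_le_nhds).comp
    (tendsto_id.atTop_div_const hb) |>.const_mul 2
  rwa [mul_div_cancel₀ _ (two_ne_zero)] at this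

lemma norm_inv_add_mul_I_le (b t : ℝ) (ht : t ≠ 0) : ‖((b : ℂ) + t * I)⁻¹‖ ≤ |t|⁻¹ := by
  rw [norm_inv]
  refine inv_anti₀ (abs_pos.2 ht) ?_
  simpa using Complex.abs_im_le_norm ((b : ℂ) + t * I)

/-- Shifting a symmetric vertical integral across one simple pole. -/
lemma tendsto_vertical_integral_inv_sub {a b p : ℝ} (ha : a < p) (hb : p < b) :
    Tendsto (fun U : ℝ => (∫ t in (-U)..U, ((b : ℂ) + t * I - p)⁻¹)
      - ∫ t in (-U)..U, ((a : ℂ) + t * I - p)⁻¹) atTop (𝓝 (2 * π)) := by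
  have h1 := tendsto_integral_inv_add_mul_I (sub_pos.2 hb)
  have h2 := tendsto_integral_inv_add_mul_I (sub_pos.2 ha)
  convert h1.add h2 using 2 with U
  · have h3 := integral_inv_add_mul_I_neg (p - a) U
    rw [sub_eq_add_neg, ← neg_eq_iff_eq_neg.2 h3]
    push_cast
    congr 1
    · congr 1; ext t; congr 1; ring
    · congr 2; ext t; congr 1; ring
  · ring

lemma norm_exp_add_mul_I_mul (c t L : ℝ) : ‖Complex.exp ((c + t * I) * L)‖ = Real.exp (c * L) := by
  rw [Complex.norm_exp]; simp

lemma norm_perronKernel_le {c L : ℝ} (hc : 1 ≤ c) (hL : L ≠ 0) {U : ℝ} (hU : 0 ≤ U) :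
    ‖∫ t in (-U)..U, Complex.exp ((c + t * I) * L) / (c + t * I)‖
      ≤ Real.exp (c * L) * ((2 + π) / |L|) := by
  have hc0 : c ≠ 0 := by linarith
  set u : ℝ → ℂ := fun t => ((c : ℂ) + t * I)⁻¹ with hu
  set u' : ℝ → ℂ := fun t => -I / ((c : ℂ) + t * I) ^ 2 with hu'
  set v : ℝ → ℂ := fun t => Complex.exp ((c + t * I) * L) / (I * L) with hv
  set v' : ℝ → ℂ := fun t => Complex.exp ((c + t * I) * L) with hv'
  have hLc : (L : ℂ) ≠ 0 := by exact_mod_cast hL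
  have hlin : ∀ t : ℝ, HasDerivAt (fun t : ℝ => (c : ℂ) + t * I) I t := fun t => by
    simpa using ((hasDerivAt_id t).ofReal_comp.mul_const I).const_add (c : ℂ)
  have hdu : ∀ t, HasDerivAt u (u' t) t := fun t => (hlin t).inv (add_mul_I_ne_zero hc0)
  have hdv : ∀ t, HasDerivAt v (v' t) t := fun t => by
    have := ((hlin t).mul_const (L : ℂ)).cexp.div_const (I * L)
    rwa [mul_div_assoc, div_self (mul_ne_zero I_ne_zero hLc), mul_one] at this
  have hcu' : Continuous u' := Continuous.div₀ (by fun_prop) (by fun_prop)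
    fun t => pow_ne_zero _ (add_mul_I_ne_zero hc0)
  have hcv' : Continuous v' := by fun_prop
  have hcv : Continuous v := continuous_iff_continuousAt.2 fun t => (hdv t).continuousAt
  have hsq : ∀ t : ℝ, 1 + t ^ 2 ≤ ‖(c : ℂ) + t * I‖ ^ 2 := fun t => by
    rw [← Complex.normSq_eq_norm_sq, Complex.normSq_add_mul_I]
    nlinarith
  have hnv : ∀ t, ‖v t‖ = Real.exp (c * L) / |L| := fun t => by
    simp only [hv, norm_div, norm_exp_add_mul_I_mul, norm_mul, norm_I, one_mul, norm_real,
      Real.norm_eq_abs]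
  have hnu : ∀ t, ‖u t‖ ≤ 1 := fun t => by
    rw [norm_inv]
    refine inv_le_one_of_one_le₀ ?_
    nlinarith [hsq t, sq_nonneg t, norm_nonneg ((c : ℂ) + t * I)]
  have hnu' : ∀ t, ‖u' t‖ ≤ (1 + t ^ 2)⁻¹ := fun t => by
    simp only [hu', norm_div, norm_neg, norm_I, norm_pow, one_div]
    exact inv_anti₀ (by positivity) (hsq t)
  have hA : 0 ≤ Real.exp (c * L) / |L| := by positivity
  have hparts := intervalIntegral.integral_mul_deriv_eq_deriv_mul (a := -U) (b := U)
    (fun t _ => hdu t) (fun t _ => hdv t) (hcu'.intervalIntegrable _ _)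
    (hcv'.intervalIntegrable _ _)
  have hint : ‖∫ t in (-U)..U, u' t * v t‖ ≤ π * (Real.exp (c * L) / |L|) := by
    calc _ ≤ ∫ t in (-U)..U, (1 + t ^ 2)⁻¹ * (Real.exp (c * L) / |L|) := by
          refine intervalIntegral.norm_integral_le_of_norm_le (by linarith)
            (Eventually.of_forall fun t _ => ?_) ?_
          · rw [norm_mul, hnv]
            gcongr
            exact hnu' t
          · refine Continuous.intervalIntegrable ?_ _ _
            exact (Continuous.inv₀ (by fun_prop) fun t => by positivity).mul_const _
      _ = (Real.arctan U - Real.arctan (-U)) * (Real.exp (c * L) / |L|) := by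
          rw [intervalIntegral.integral_mul_const, integral_inv_one_add_sq]
      _ ≤ _ := by
          gcongr
          rw [Real.arctan_neg]
          linarith [Real.arctan_lt_pi_div_two U]
  have heq : ∫ t in (-U)..U, Complex.exp ((c + t * I) * L) / (c + t * I)
      = ∫ t in (-U)..U, u t * v' t := by
    congr 1; ext t; simp only [hu, hv']; ring
  rw [heq, hparts]
  calc _ ≤ ‖u U * v U‖ + ‖u (-U) * v (-U)‖ + ‖∫ t in (-U)..U, u' t * v t‖ :=
        (norm_sub_le _ _).trans (add_le_add_left (norm_sub_le _ _) _)
    _ ≤ 1 * (Real.exp (c * L) / |L|) + 1 * (Real.exp (c * L) / |L|)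
        + π * (Real.exp (c * L) / |L|) := by
        rw [norm_mul, norm_mul, hnv, hnv]
        gcongr <;> exact hnu _
    _ = _ := by ring

lemma norm_exp_mul_inv_le {σ t L M : ℝ} (hM : Real.exp (σ * L) ≤ M) (ht : 1 ≤ |t|) :
    ‖Complex.exp ((σ + t * I) * L) / (σ + t * I)‖ ≤ M * |t|⁻¹ := by
  rw [div_eq_mul_inv, norm_mul, norm_exp_add_mul_I_mul]
  have := norm_inv_add_mul_I_le σ t (by intro h; simp [h] at ht; linarith)
  have h0 := (Real.exp_pos (σ * L)).le.trans hM
  gcongr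

lemma tendsto_const_mul_inv_atTop (M : ℝ) : Tendsto (fun x : ℝ => M * x⁻¹) atTop (𝓝 0) := by
  simpa using tendsto_inv_atTop_zero.const_mul M

lemma tendsto_perronKernel_of_neg {c L : ℝ} (hc : 1 ≤ c) (hL : L < 0) :
    Tendsto (fun U : ℝ => ∫ t in (-U)..U, Complex.exp ((c + t * I) * L) / (c + t * I))
      atTop (𝓝 0) := by
  have hdecay : Tendsto (fun b : ℝ => Real.exp (b * L) * ((2 + π) / |L|)) atTop (𝓝 0) := by
    have := Real.tendsto_exp_atBot.comp (tendsto_id.atTop_mul_const_of_neg hL)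
    simpa using this.mul_const ((2 + π) / |L|)
  rw [Metric.tendsto_atTop']
  intro ε hε
  obtain ⟨b, hb, hcb⟩ := ((hdecay.eventually (gt_mem_nhds (half_pos hε))).and
    (eventually_ge_atTop c)).exists
  have hshift := tendsto_vertical_integral_sub_of_decay (a := c) (b := b)
    (g := fun s => Complex.exp (s * L) / s) hcb
    (fun s hs _ => by
      have : s ≠ 0 := by rintro rfl; simp at hs; linarith
      fun_prop (disch := assumption)) (tendsto_const_mul_inv_atTop 1)
    (fun σ t h1 _ ht => norm_exp_mul_inv_le
      (Real.exp_le_one_iff.2 (mul_nonpos_of_nonneg_of_nonpos (by linarith) hL.le)) ht)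
  obtain ⟨N, hN⟩ := Metric.tendsto_atTop'.1 hshift (ε / 2) (half_pos hε)
  refine ⟨max N 0, fun U hU => ?_⟩
  have h1 := hN U ((le_max_left _ _).trans_lt hU)
  have h2 := norm_perronKernel_le (hc.trans hcb) hL.ne ((le_max_right _ _).trans hU.le)
  rw [dist_zero_right] at h1 ⊢
  have h3 := norm_sub_norm_le (∫ t in (-U)..U, Complex.exp ((c + t * I) * L) / (c + t * I))
    (∫ t in (-U)..U, Complex.exp ((b + t * I) * L) / (b + t * I))
  rw [norm_sub_rev] at h3
  linarith

lemma perronKernel_neg (c L U : ℝ) :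
    ∫ t in (-U)..U, Complex.exp (((-c : ℝ) + t * I) * L) / ((-c : ℝ) + t * I)
      = -∫ t in (-U)..U, Complex.exp ((c + t * I) * (-L : ℝ)) / (c + t * I) := by
  have := intervalIntegral.integral_comp_neg (a := -U) (b := U)
    (fun t : ℝ => Complex.exp (((-c : ℝ) + t * I) * L) / ((-c : ℝ) + t * I))
  rw [neg_neg] at this
  rw [← this, ← intervalIntegral.integral_neg]
  congr 1; ext t
  rw [← div_neg]
  congr 1
  · congr 1; push_cast; ring
  · push_cast; ring

/-- Shifting a symmetric vertical integral across simple poles `p ∈ S` with residues `r p`. -/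
lemma tendsto_vertical_integral_sub_of_poles {G : ℂ → ℂ} {a b : ℝ} (hab : a ≤ b)
    (S : Finset ℝ) (r : ℝ → ℂ) (hS : ∀ p ∈ S, a < p ∧ p < b)
    {g : ℂ → ℂ} (hg : ∀ s : ℂ, a ≤ s.re → s.re ≤ b → DifferentiableAt ℂ g s)
    (hG : ∀ s : ℂ, a ≤ s.re → s.re ≤ b → (∀ p ∈ S, s ≠ p) → G s = g s + ∑ p ∈ S, r p * (s - p)⁻¹)
    {B : ℝ → ℝ} (hB : Tendsto B atTop (𝓝 0))
    (hGB : ∀ σ t : ℝ, a ≤ σ → σ ≤ b → 1 ≤ |t| → ‖G (σ + t * I)‖ ≤ B |t|) :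
    Tendsto (fun U : ℝ => (∫ t in (-U)..U, G (b + t * I)) - ∫ t in (-U)..U, G (a + t * I))
      atTop (𝓝 (2 * π * ∑ p ∈ S, r p)) := by
  have hB' : Tendsto (fun x => B x + ∑ p ∈ S, ‖r p‖ * x⁻¹) atTop (𝓝 0) := by
    simpa using hB.add (tendsto_finsetSum S fun p _ => tendsto_const_mul_inv_atTop ‖r p‖)
  have hsub : ∀ (σ t p : ℝ), (σ : ℂ) + t * I - p = ((σ - p : ℝ) : ℂ) + t * I := by
    intro σ t p; push_cast; ring
  have h1 := tendsto_vertical_integral_sub_of_decay hab hg hB' fun σ t h1 h2 ht => by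
    have ht0 : t ≠ 0 := by rintro rfl; simp at ht; linarith
    have hGs := hG (σ + t * I) (by simpa using h1) (by simpa using h2) fun p _ h => ht0 (by
      simpa using congrArg Complex.im h)
    have : g (σ + t * I) = G (σ + t * I) - ∑ p ∈ S, r p * ((σ : ℂ) + t * I - p)⁻¹ := by
      rw [hGs]; ring
    rw [this]
    refine (norm_sub_le _ _).trans (add_le_add (hGB σ t h1 h2 ht)
      ((norm_sum_le _ _).trans (Finset.sum_le_sum fun p _ => ?_)))
    rw [norm_mul, hsub]
    gcongr
    exact norm_inv_add_mul_I_le _ t ht0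
  have h2 := tendsto_finsetSum S fun p hp =>
    (tendsto_vertical_integral_inv_sub (hS p hp).1 (hS p hp).2).const_mul (r p)
  have h3 := h1.add h2
  rw [zero_add, ← Finset.sum_mul, mul_comm] at h3
  refine h3.congr fun U => ?_
  have hline : ∀ σ : ℝ, a ≤ σ → σ ≤ b → (∀ p ∈ S, σ ≠ p) →
      ∫ t in (-U)..U, G (σ + t * I) = (∫ t in (-U)..U, g (σ + t * I))
        + ∑ p ∈ S, r p * ∫ t in (-U)..U, ((σ : ℂ) + t * I - p)⁻¹ := by
    intro σ h1 h2 hσ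
    have hc : ∀ p ∈ S, Continuous fun t : ℝ => r p * ((σ : ℂ) + t * I - p)⁻¹ := fun p hp => by
      simp_rw [hsub]
      exact (continuous_inv_add_mul_I (sub_ne_zero.2 (hσ p hp))).const_mul _
    have hcg : Continuous fun t : ℝ => g (σ + t * I) := continuous_iff_continuousAt.2 fun t =>
      ContinuousAt.comp (f := fun t : ℝ => (σ : ℂ) + t * I)
        (hg _ (by simpa using h1) (by simpa using h2)).continuousAt (by fun_prop)
    simp_rw [← intervalIntegral.integral_const_mul]
    rw [← intervalIntegral.integral_finsetSum fun p hp => (hc p hp).intervalIntegrable _ _,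
      ← intervalIntegral.integral_add (hcg.intervalIntegrable _ _)
        ((continuous_finsetSum S hc).intervalIntegrable _ _)]
    congr 1; ext t
    exact hG _ (by simpa using h1) (by simpa using h2) fun p hp h => hσ p hp (by
      simpa using congrArg Complex.re h)
  rw [hline b hab le_rfl fun p hp => (hS p hp).2.ne', hline a le_rfl hab fun p hp => (hS p hp).1.ne]
  simp_rw [mul_sub, Finset.sum_sub_distrib]
  ring

lemma tendsto_perronKernel_of_pos {c L : ℝ} (hc : 1 ≤ c) (hL : 0 < L) :
    Tendsto (fun U : ℝ => ∫ t in (-U)..U, Complex.exp ((c + t * I) * L) / (c + t * I))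
      atTop (𝓝 (2 * π)) := by
  have hd : Differentiable ℂ fun s : ℂ => Complex.exp (s * L) := by fun_prop
  have h1 := tendsto_vertical_integral_sub_of_poles (a := -c) (b := c) (by linarith)
    (G := fun s => Complex.exp (s * L) / s) {0} (fun _ => 1) (by simp; linarith)
    (g := dslope (fun s : ℂ => Complex.exp (s * L)) 0)
    (fun s _ _ => by
      have := (Complex.differentiableOn_dslope (s := univ) (c := (0 : ℂ)) univ_mem).2
        hd.differentiableOn
      exact this.differentiableAt univ_mem)
    (fun s _ _ hs => by
      have hs : s ≠ 0 := by simpa using hs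
      rw [dslope_of_ne _ hs, slope_def_field]
      simp only [Finset.sum_singleton, ofReal_zero, sub_zero, zero_mul, Complex.exp_zero]
      field_simp
      ring) (tendsto_const_mul_inv_atTop (Real.exp (c * L)))
    (fun σ t _ h2 ht => norm_exp_mul_inv_le (by gcongr) ht)
  have h2 := tendsto_perronKernel_of_neg hc (neg_lt_zero.2 hL)
  have h3 := h1.sub h2
  simp only [Finset.sum_singleton, mul_one, sub_zero] at h3
  refine h3.congr fun U => ?_
  rw [perronKernel_neg]
  ring

/-- The terms of the series `∑ₙ (s - 1) ∫ₙⁿ⁺¹ (n⁻ˢ - u⁻ˢ) du` representing `(s - 1) ζ(s) - 1` in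
the right half plane. -/
noncomputable def zetaTerm (n : ℕ) (s : ℂ) : ℂ :=
  (s - 1) * ((n + 1 : ℝ) : ℂ) ^ (-s) - ((n + 1 : ℝ) : ℂ) ^ (1 - s) + ((n + 2 : ℝ) : ℂ) ^ (1 - s)

lemma norm_cpow_neg_sub_cpow_neg_le {s : ℂ} (hs : 1 / 4 ≤ s.re) {m u : ℝ} (hm : 1 ≤ m)
    (hu : u ∈ Icc m (m + 1)) :
    ‖(m : ℂ) ^ (-s) - (u : ℂ) ^ (-s)‖ ≤ 2 * ‖s‖ ^ (7 / 8 : ℝ) * m ^ (-(9 / 8) : ℝ) := by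
  have hm0 : 0 < m := by linarith
  have hs0 : s ≠ 0 := by rintro rfl; simp at hs; linarith
  have h1 : ‖(m : ℂ) ^ (-s) - (u : ℂ) ^ (-s)‖ ≤ ‖s‖ * m ^ (-s.re - 1) := by
    have := (convex_Icc m (m + 1)).norm_image_sub_le_of_norm_hasDerivWithin_le
      (f := fun u : ℝ => (u : ℂ) ^ (-s)) (f' := fun u : ℝ => -s * (u : ℂ) ^ (-s - 1))
      (C := ‖s‖ * m ^ (-s.re - 1)) (fun v hv => by
        have hv0 : v ≠ 0 := by linarith [hv.1]
        have := hasDerivAt_ofReal_cpow_const' (x := v) (r := -s - 1) hv0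
          (by simpa using hs0)
        rw [sub_add_cancel] at this
        have h2 := this.const_mul (-s)
        refine (HasDerivAt.congr_deriv h2 rfl |>.congr_of_eventuallyEq ?_).hasDerivWithinAt
        refine Eventually.of_forall fun y => ?_
        simp only
        field_simp)
      (fun v hv => by
        have hv0 : 0 < v := by linarith [hv.1]
        rw [norm_mul, norm_neg, norm_cpow_eq_rpow_re_of_pos hv0]
        simp only [sub_re, neg_re, one_re]
        gcongr ?_ * ?_
        exact Real.rpow_le_rpow_of_nonpos hm0 hv.1 (by linarith)) hu
      (left_mem_Icc.2 (by linarith))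
    refine this.trans (mul_le_of_le_one_right (by positivity) ?_)
    rw [Real.norm_eq_abs, abs_le]
    constructor <;> linarith [hu.1, hu.2]
  have h2 : ‖(m : ℂ) ^ (-s) - (u : ℂ) ^ (-s)‖ ≤ 2 * m ^ (-s.re) := by
    refine (norm_sub_le _ _).trans ?_
    rw [norm_cpow_eq_rpow_re_of_pos hm0, norm_cpow_eq_rpow_re_of_pos (by linarith [hu.1])]
    have := Real.rpow_le_rpow_of_nonpos hm0 hu.1 (by linarith : -s.re ≤ 0)
    simp only [neg_re]
    linarith
  set N := ‖(m : ℂ) ^ (-s) - (u : ℂ) ^ (-s)‖ with hN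
  have hN0 : 0 ≤ N := norm_nonneg _
  calc N = N ^ (7 / 8 : ℝ) * N ^ (1 / 8 : ℝ) := by
        rw [← Real.rpow_add' hN0 (by norm_num)]; norm_num
    _ ≤ (‖s‖ * m ^ (-s.re - 1)) ^ (7 / 8 : ℝ) * (2 * m ^ (-s.re)) ^ (1 / 8 : ℝ) := by gcongr
    _ = (2 : ℝ) ^ (1 / 8 : ℝ) * ‖s‖ ^ (7 / 8 : ℝ) * m ^ (-s.re - 7 / 8) := by
        rw [Real.mul_rpow (by positivity) (by positivity), Real.mul_rpow (by positivity)
          (by positivity), ← Real.rpow_mul hm0.le, ← Real.rpow_mul hm0.le]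
        rw [show -s.re - 7 / 8 = (-s.re - 1) * (7 / 8) + -s.re * (1 / 8) by ring,
          Real.rpow_add hm0]
        ring
    _ ≤ _ := by
        gcongr
        · exact (Real.rpow_le_rpow_of_exponent_le (by norm_num) (by norm_num)).trans_eq
            (Real.rpow_one 2)
        linarith

lemma norm_zetaTerm_le (n : ℕ) {s : ℂ} (hs : 1 / 4 ≤ s.re) :
    ‖zetaTerm n s‖ ≤ 2 * ‖s - 1‖ * ‖s‖ ^ (7 / 8 : ℝ) * (n + 1 : ℝ) ^ (-(9 / 8) : ℝ) := by
  by_cases hs1 : s = 1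
  · simp [zetaTerm, hs1]
  set m : ℝ := n + 1 with hm
  have hm1 : 1 ≤ m := by simp [hm]
  have := (convex_Icc m (m + 1)).norm_image_sub_le_of_norm_hasDerivWithin_le
    (f := fun u : ℝ => (s - 1) * ((m : ℂ) ^ (-s) * u) + (u : ℂ) ^ (1 - s))
    (f' := fun u : ℝ => (s - 1) * ((m : ℂ) ^ (-s) - (u : ℂ) ^ (-s)))
    (C := ‖s - 1‖ * (2 * ‖s‖ ^ (7 / 8 : ℝ) * m ^ (-(9 / 8) : ℝ))) (fun v hv => by
      have hv0 : v ≠ 0 := by linarith [hv.1]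
      have h1s : 1 - s ≠ 0 := sub_ne_zero.2 (Ne.symm hs1)
      have h1 := hasDerivAt_ofReal_cpow_const' (x := v) (r := -s) hv0
        (by simpa using hs1)
      have h2 := ((((hasDerivAt_id v).ofReal_comp).const_mul ((m : ℂ) ^ (-s))).const_mul
        (s - 1)).add (h1.const_mul (1 - s))
      refine ((h2.congr_deriv ?_).congr_of_eventuallyEq ?_).hasDerivWithinAt
      · simp only [ofReal_one]; ring
      · refine Eventually.of_forall fun y => ?_
        simp only [Pi.add_apply, id]
        rw [neg_add_eq_sub]
        field_simp)
    (fun v hv => by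
      rw [norm_mul]
      gcongr
      exact norm_cpow_neg_sub_cpow_neg_le hs hm1 hv)
    (left_mem_Icc.2 (by linarith)) (right_mem_Icc.2 (by linarith))
  rw [add_sub_cancel_left, norm_one, mul_one] at this
  convert this using 1
  · rw [zetaTerm]
    congr 1
    rw [show (n + 2 : ℝ) = m + 1 by rw [hm]; ring, ← hm]
    push_cast
    ring
  · ring

lemma summable_zetaTerm_bound (C : ℝ) :
    Summable fun n : ℕ => C * (n + 1 : ℝ) ^ (-(9 / 8) : ℝ) := by
  have := (summable_nat_add_iff 1).2 (Real.summable_nat_rpow.2 (by norm_num : (-(9 / 8) : ℝ) < -1))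
  simpa using this.mul_left C

lemma tsum_zetaTerm_of_one_lt_re {s : ℂ} (hs : 1 < s.re) :
    ∑' n, zetaTerm n s = riemannZeta₁ s - 1 := by
  have hsum : Summable fun n => zetaTerm n s :=
    .of_norm_bounded (summable_zetaTerm_bound _) fun n => norm_zetaTerm_le n (by linarith)
  have hs1 : s ≠ 1 := by rintro rfl; simp at hs
  have hpart : ∀ N : ℕ, ∑ n ∈ Finset.range N, zetaTerm n s
      = (s - 1) * (∑ n ∈ Finset.range N, 1 / ((n : ℂ) + 1) ^ s) - 1
        + ((N + 1 : ℝ) : ℂ) ^ (1 - s) := by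
    intro N
    induction N with
    | zero => simp
    | succ N ih =>
      rw [Finset.sum_range_succ, ih, Finset.sum_range_succ, zetaTerm, cpow_neg]
      push_cast
      rw [show (N : ℂ) + 1 + 1 = N + 2 by ring]
      ring
  have hz : HasSum (fun n : ℕ => 1 / ((n : ℂ) + 1) ^ s) (riemannZeta s) := by
    rw [zeta_eq_tsum_one_div_nat_add_one_cpow hs]
    refine Summable.hasSum ?_
    have := (summable_nat_add_iff 1).2 (Complex.summable_one_div_nat_cpow.2 hs)
    simpa using this
  have hp : Tendsto (fun N : ℕ => ((N + 1 : ℝ) : ℂ) ^ (1 - s)) atTop (𝓝 0) := by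
    rw [tendsto_zero_iff_norm_tendsto_zero]
    have h1 : Tendsto (fun N : ℕ => (N + 1 : ℝ) ^ (-(s.re - 1))) atTop (𝓝 0) :=
      (tendsto_rpow_neg_atTop (sub_pos.2 hs)).comp
        (tendsto_atTop_add_const_right _ 1 tendsto_natCast_atTop_atTop)
    refine h1.congr fun N => ?_
    rw [norm_cpow_eq_rpow_re_of_pos (by positivity)]
    simp
  have h1 := hsum.hasSum.tendsto_sum_nat
  simp_rw [hpart] at h1
  have h2 := ((hz.tendsto_sum_nat.const_mul (s - 1)).sub_const 1).add hp
  rw [tendsto_nhds_unique h1 h2, riemannZeta_eq_inv_sub_mul hs1]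
  have := sub_ne_zero.2 hs1
  field_simp
  ring

lemma tsum_zetaTerm {s : ℂ} (hs : 1 / 4 < s.re) : ∑' n, zetaTerm n s = riemannZeta₁ s - 1 := by
  set R : ℝ := ‖s‖ + 3
  set U : Set ℂ := {z : ℂ | 1 / 4 < z.re} ∩ Metric.ball 0 R with hU
  have hUo : IsOpen U := (isOpen_lt continuous_const continuous_re).inter Metric.isOpen_ball
  have hUc : Convex ℝ U := (convex_halfSpace_re_gt _).inter (convex_ball _ _)
  have hd : DifferentiableOn ℂ (fun z => ∑' n, zetaTerm n z) U := by
    refine differentiableOn_tsum_of_summable_norm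
      (summable_zetaTerm_bound (2 * (R + 1) * R ^ (7 / 8 : ℝ))) (fun n => ?_) hUo fun n z hz => ?_
    · refine Differentiable.differentiableOn ?_
      have h1 : ((n + 1 : ℝ) : ℂ) ≠ 0 := by exact_mod_cast (by positivity : (n + 1 : ℝ) ≠ 0)
      have h2 : ((n + 2 : ℝ) : ℂ) ≠ 0 := by exact_mod_cast (by positivity : (n + 2 : ℝ) ≠ 0)
      unfold zetaTerm
      exact (((differentiable_id.sub_const 1).mul
        (differentiable_id.neg.const_cpow (.inl h1))).sub
        ((differentiable_id.const_sub 1).const_cpow (.inl h1))).add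
        ((differentiable_id.const_sub 1).const_cpow (.inl h2))
    · have hzR : ‖z‖ ≤ R := by simpa using (Metric.mem_ball.1 hz.2).le
      refine (norm_zetaTerm_le n (le_of_lt hz.1)).trans ?_
      gcongr
      exact (norm_sub_le _ _).trans (by simpa using hzR)
  have h2 : (2 : ℂ) ∈ U := by
    refine ⟨by norm_num, ?_⟩
    have : (0 : ℝ) ≤ ‖s‖ := norm_nonneg s
    simp [R]; linarith
  refine (hd.analyticOnNhd hUo).eqOn_of_preconnected_of_eventuallyEq
    (((differentiable_riemannZeta₁.sub_const 1).differentiableOn).analyticOnNhd hUo)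
    hUc.isPreconnected h2 ?_ ⟨hs, by simp [R]⟩
  filter_upwards [(isOpen_lt continuous_const continuous_re).mem_nhds
    (by norm_num : (1 : ℝ) < (2 : ℂ).re)] with z hz
  exact tsum_zetaTerm_of_one_lt_re hz

lemma exists_norm_riemannZeta₁_le :
    ∃ C : ℝ, 0 < C ∧ ∀ s : ℂ, 1 / 4 < s.re →
      ‖riemannZeta₁ s‖ ≤ 1 + C * ‖s - 1‖ * ‖s‖ ^ (7 / 8 : ℝ) := by
  have hS := summable_zetaTerm_bound 2
  refine ⟨∑' n : ℕ, 2 * (n + 1 : ℝ) ^ (-(9 / 8) : ℝ),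
    hS.tsum_pos (fun n => by positivity) 0 (by norm_num), fun s hs => ?_⟩
  have h1 : riemannZeta₁ s = 1 + ∑' n, zetaTerm n s := by rw [tsum_zetaTerm hs]; ring
  rw [h1]
  refine (norm_add_le _ _).trans ?_
  rw [norm_one]
  gcongr
  have h2 := tsum_of_norm_bounded (hS.mul_left (‖s - 1‖ * ‖s‖ ^ (7 / 8 : ℝ))).hasSum
    fun n => (norm_zetaTerm_le n hs.le).trans_eq (by ring)
  rw [tsum_mul_left] at h2
  linarith

lemma norm_logDeriv_le_of_norm_le {F : ℂ → ℂ} {z₀ : ℂ} {M r R : ℝ} (hM : 0 < M) (hr : 0 ≤ r)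
    (hrR : r < R) (hF : Differentiable ℂ F) (hF0 : ∀ z ∈ Metric.ball z₀ R, F z ≠ 0)
    (hFM : ∀ z ∈ Metric.ball z₀ R, ‖F z‖ ≤ Real.exp M * ‖F z₀‖) {z : ℂ}
    (hz : z ∈ Metric.closedBall z₀ r) :
    ‖deriv F z / F z‖ ≤ 8 * M * R / (R - r) ^ 2 := by
  have hR : 0 < R := hr.trans_lt hrR
  have hz₀ : z₀ ∈ Metric.ball z₀ R := Metric.mem_ball_self hR
  have hlog : DifferentiableOn ℂ (fun z => deriv F z / F z) (Metric.ball z₀ R) :=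
    hF.deriv.differentiableOn.div hF.differentiableOn hF0
  obtain ⟨f, hf0, hf⟩ := hlog.isExactOn_ball.with_val_at z₀ 0
  have hexp : ∀ w ∈ Metric.ball z₀ R, F w = F z₀ * Complex.exp (f w) := by
    intro w hw
    have hconst := (convex_ball z₀ R).is_const_of_fderivWithin_eq_zero (𝕜 := ℂ)
      (f := fun w => Complex.exp (-f w) * F w) ?_ ?_ hw hz₀
    · simp only [hf0, neg_zero, Complex.exp_zero, one_mul] at hconst
      rw [← hconst, mul_right_comm, ← Complex.exp_add]
      simp
    · exact fun y hy => (((hf y hy).neg.cexp.mul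
        (hF y).hasDerivAt).differentiableAt).differentiableWithinAt
    · intro y hy
      have h1 := (hf y hy).neg.cexp.mul (hF y).hasDerivAt
      have h2 : HasDerivAt (fun w => Complex.exp (-f w) * F w) 0 y := by
        refine h1.congr_deriv ?_
        have := hF0 y hy
        field_simp
        ring
      have h3 := h2.hasFDerivAt.hasFDerivWithinAt.fderivWithin
        (Metric.isOpen_ball.uniqueDiffWithinAt hy)
      simpa using h3
  have hmem : ∀ w ∈ Metric.ball (0 : ℂ) R, z₀ + w ∈ Metric.ball z₀ R := fun w hw => by
    simpa [Metric.mem_ball, dist_eq_norm] using hw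
  have hbound : ∀ w ∈ Metric.ball z₀ R, ‖f w‖ ≤ 2 * M * ‖w - z₀‖ / (R - ‖w - z₀‖) := by
    intro w hw
    have := borelCaratheodory_zero (f := fun w => f (z₀ + w)) hM (R := R) (z := w - z₀) ?_ ?_ hR
      (by simpa [Metric.mem_ball, dist_eq_norm] using hw) (by simpa using hf0)
    · simpa using this
    · intro w hw
      exact (((hf _ (hmem w hw)).comp_const_add z₀ w).differentiableAt).differentiableWithinAt
    · intro w hw
      have h1 := hFM _ (hmem w hw)
      rw [hexp _ (hmem w hw), norm_mul, mul_comm, Complex.norm_exp] at h1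
      exact Real.exp_le_exp.1 (le_of_mul_le_mul_right h1 (norm_pos_iff.2 (hF0 _ hz₀)))
  have hzr : ‖z - z₀‖ ≤ r := by simpa [dist_eq_norm] using hz
  have hzR : z ∈ Metric.ball z₀ R := Metric.closedBall_subset_ball hrR hz
  set δ := (R - r) / 2 with hδ
  have hδ0 : 0 < δ := by simp [hδ]; linarith
  have hnear : ∀ w, dist w z ≤ δ → ‖w - z₀‖ ≤ (R + r) / 2 := fun w hw => by
    have : ‖w - z‖ ≤ δ := by simpa [dist_eq_norm] using hw
    have h2 := norm_add_le (w - z) (z - z₀)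
    rw [sub_add_sub_cancel] at h2
    simp only [hδ] at this
    linarith
  have hnear' : ∀ w, dist w z ≤ δ → w ∈ Metric.ball z₀ R := fun w hw => by
    have := hnear w hw
    rw [Metric.mem_ball, dist_eq_norm]; linarith
  rw [← (hf z hzR).deriv]
  have hC : ∀ w ∈ Metric.sphere z δ, ‖f w‖ ≤ 4 * M * R / (R - r) := by
    intro w hw
    have hw' : dist w z ≤ δ := (Metric.mem_sphere.1 hw).le
    refine (hbound w (hnear' w hw')).trans ?_
    have h1 := hnear w hw'
    rw [div_le_div_iff₀ (by linarith) (by linarith)]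
    have h2 : ‖w - z₀‖ ≤ R := by linarith
    nlinarith [mul_nonneg hM.le (sub_nonneg.2 h1), mul_nonneg hM.le (norm_nonneg (w - z₀)),
      mul_nonneg (mul_nonneg hM.le (sub_nonneg.2 h1)) hR.le,
      mul_nonneg (mul_nonneg hM.le (sub_nonneg.2 h2)) (sub_nonneg.2 hrR.le)]
  have hcd : DiffContOnCl ℂ f (Metric.ball z δ) := by
    refine DifferentiableOn.diffContOnCl fun w hw => ?_
    have := Metric.closure_ball_subset_closedBall hw
    exact ((hf w (hnear' w this)).differentiableAt).differentiableWithinAt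
  refine (Complex.norm_deriv_le_of_forall_mem_sphere_norm_le hδ0 hcd hC).trans_eq ?_
  have : R - r ≠ 0 := by linarith
  rw [hδ]
  field_simp
  ring

lemma exists_one_le_mul_norm_riemannZeta :
    ∃ K : ℝ, 1 ≤ K ∧ ∀ t : ℝ, 1 ≤ K * ‖riemannZeta (2 + t * I)‖ := by
  set μ' : ℕ → ℂ := fun n => (ArithmeticFunction.moebius n : ℂ)
  refine ⟨1 + ∑' n, ‖LSeries.term μ' 2 n‖, le_add_of_nonneg_right (tsum_nonneg fun _ =>
    norm_nonneg _), fun t => ?_⟩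
  have hre : 1 < ((2 : ℂ) + t * I).re := by simp
  have h1 := ArithmeticFunction.LSeries_zeta_mul_Lseries_moebius hre
  rw [ArithmeticFunction.LSeries_zeta_eq_riemannZeta hre] at h1
  have h2 := congrArg norm h1
  rw [norm_mul, norm_one] at h2
  have h3 : ‖LSeries μ' (2 + t * I)‖ ≤ ∑' n, ‖LSeries.term μ' 2 n‖ := by
    have hterm : ∀ n, ‖LSeries.term μ' (2 + t * I) n‖ = ‖LSeries.term μ' 2 n‖ := fun n => by
      rw [LSeries.norm_term_eq, LSeries.norm_term_eq]; simp
    have hs : Summable fun n => ‖LSeries.term μ' 2 n‖ :=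
      (ArithmeticFunction.LSeriesSummable_moebius_iff.2 (by norm_num)).norm
    exact tsum_of_norm_bounded hs.hasSum fun n => (hterm n).le
  have h4 := mul_le_mul_of_nonneg_left h3 (norm_nonneg (riemannZeta (2 + t * I)))
  nlinarith [norm_nonneg (riemannZeta (2 + t * I)), h2, h4]

lemma riemannZeta₁_eq {s : ℂ} (hs : s ≠ 1) : riemannZeta₁ s = (s - 1) * riemannZeta s := by
  rw [riemannZeta_eq_inv_sub_mul hs, mul_inv_cancel_left₀ (sub_ne_zero.2 hs)]

lemma riemannZeta₁_ne_zero_of_half_lt_re (hRH : RiemannHypothesis) {s : ℂ} (hs : 1 / 2 < s.re) :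
    riemannZeta₁ s ≠ 0 := by
  by_cases h1 : s = 1
  · simp [h1]
  rw [riemannZeta₁_eq h1]
  refine mul_ne_zero (sub_ne_zero.2 h1) fun h0 => ?_
  have := hRH s h0 ?_ h1
  · linarith
  · rintro ⟨n, rfl⟩
    norm_num at hs
    linarith [(Nat.cast_nonneg n : (0 : ℝ) ≤ n)]

lemma exists_norm_logDeriv_riemannZeta₁_le (hRH : RiemannHypothesis) {α : ℝ} (hα0 : 0 < α)
    (hα : α < 1 / 2) :
    ∃ A : ℝ, 0 ≤ A ∧ ∀ σ t : ℝ, 1 / 2 + α ≤ σ → σ ≤ 2 →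
      ‖deriv riemannZeta₁ (σ + t * I) / riemannZeta₁ (σ + t * I)‖
        ≤ A * (|t| + 4) ^ (1 / 16 : ℝ) := by
  obtain ⟨C, hC0, hC⟩ := exists_norm_riemannZeta₁_le
  obtain ⟨K, hK1, hK⟩ := exists_one_le_mul_norm_riemannZeta
  set D := K * (1 + C) with hD
  have hD1 : 1 ≤ D := by nlinarith
  refine ⟨8 * (32 * D ^ (1 / 32 : ℝ)) * (3 / 2) / α ^ 2, by positivity, fun σ t hσ hσ2 => ?_⟩
  set T := |t| + 4 with hT
  have hT4 : 4 ≤ T := by simp [hT]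
  set M := Real.log (D * T ^ 2) with hM
  have hDT : 1 < D * T ^ 2 := by nlinarith
  have hM0 : 0 < M := Real.log_pos hDT
  have hexpM : Real.exp M = D * T ^ 2 := Real.exp_log (by linarith)
  have hMle : M ≤ 32 * D ^ (1 / 32 : ℝ) * T ^ (1 / 16 : ℝ) := by
    refine (Real.log_le_rpow_div (by positivity) (by norm_num : (0 : ℝ) < 1 / 32)).trans_eq ?_
    rw [Real.mul_rpow (by positivity) (by positivity), ← Real.rpow_natCast,
      ← Real.rpow_mul (by positivity)]
    norm_num
    ring
  have hz₀ : 1 ≤ K * ‖riemannZeta₁ (2 + t * I)‖ := by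
    have hne : (2 : ℂ) + t * I ≠ 1 := fun h => by simpa using congrArg re h
    rw [riemannZeta₁_eq hne, norm_mul]
    have h1 : 1 ≤ ‖(2 : ℂ) + t * I - 1‖ := by
      refine le_trans ?_ (abs_re_le_norm _)
      norm_num
    have := hK t
    nlinarith [norm_nonneg (riemannZeta (2 + t * I))]
  have key := norm_logDeriv_le_of_norm_le (F := riemannZeta₁) (z₀ := 2 + t * I) (R := 3 / 2)
    (r := 3 / 2 - α) (z := σ + t * I) hM0 (by linarith) (by linarith) differentiable_riemannZeta₁ ?_ ?_ ?_
  · refine key.trans ?_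
    rw [sub_sub_cancel]
    calc 8 * M * (3 / 2) / α ^ 2
        ≤ 8 * (32 * D ^ (1 / 32 : ℝ) * T ^ (1 / 16 : ℝ)) * (3 / 2) / α ^ 2 := by gcongr
      _ = _ := by ring
  · intro z hz
    refine riemannZeta₁_ne_zero_of_half_lt_re hRH ?_
    have := (abs_re_le_norm _).trans_lt (mem_ball_iff_norm.1 hz)
    simp [abs_lt] at this
    linarith
  · intro z hz
    have hzn := mem_ball_iff_norm.1 hz
    have hre := (abs_re_le_norm _).trans_lt hzn
    simp [abs_lt] at hre
    have h2t : ‖(1 : ℂ) + t * I‖ ≤ 1 + |t| := (norm_add_le _ _).trans (by simp)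
    have h1 : ‖z - 1‖ ≤ T := by
      have := norm_add_le (z - (2 + t * I)) (1 + t * I)
      rw [show z - (2 + t * I) + (1 + t * I) = z - 1 by ring] at this
      linarith
    have h0 : ‖z‖ ≤ T := by
      have := norm_add_le (z - (2 + t * I)) (1 + t * I + 1)
      rw [show z - (2 + t * I) + (1 + t * I + 1) = z by ring] at this
      have h3 := norm_add_le ((1 : ℂ) + t * I) 1
      rw [norm_one] at h3
      linarith
    have h5 : ‖z‖ ^ (7 / 8 : ℝ) ≤ T :=
      (Real.rpow_le_rpow (norm_nonneg _) h0 (by norm_num)).trans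
        ((Real.rpow_le_rpow_of_exponent_le (by linarith) (by norm_num)).trans_eq (Real.rpow_one T))
    calc ‖riemannZeta₁ z‖ ≤ 1 + C * ‖z - 1‖ * ‖z‖ ^ (7 / 8 : ℝ) := hC z (by linarith)
      _ ≤ 1 + C * T * T := by gcongr
      _ ≤ (1 + C) * T ^ 2 := by nlinarith
      _ ≤ (1 + C) * T ^ 2 * (K * ‖riemannZeta₁ (2 + t * I)‖) :=
        le_mul_of_one_le_right (by positivity) hz₀
      _ = _ := by rw [hexpM, hD]; ring
  · rw [mem_closedBall_iff_norm]
    rw [show (σ : ℂ) + t * I - (2 + t * I) = ((σ - 2 : ℝ) : ℂ) by push_cast; ring, norm_real,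
      Real.norm_eq_abs, abs_of_nonpos (by linarith)]
    linarith

lemma tendsto_vertical_integral_LSeries {a : ℕ → ℂ} {c x : ℝ} (hc : 1 ≤ c)
    (ha : LSeriesSummable a c) (hx : 0 < x) (hxZ : ∀ n : ℕ, (n : ℝ) ≠ x) :
    Tendsto (fun U : ℝ => ∫ t in (-U)..U,
      LSeries a (c + t * I) * (x : ℂ) ^ ((c : ℂ) + t * I) / (c + t * I)) atTop
      (𝓝 (2 * π * ∑ n ∈ Finset.Icc 1 ⌊x⌋₊, a n)) := by
  have hc0 : c ≠ 0 := by linarith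
  set ℓ : ℕ → ℝ := fun n => Real.log x - Real.log n with hℓ
  have hℓ_lim : Tendsto ℓ atTop atBot :=
    tendsto_atBot_add_const_left _ _
      (tendsto_neg_atTop_atBot.comp (Real.tendsto_log_atTop.comp tendsto_natCast_atTop_atTop))
  obtain ⟨D, hD⟩ : ∃ D, ∀ n, |ℓ n|⁻¹ ≤ D := by
    have h1 := tendsto_inv_atTop_zero.comp (tendsto_abs_atBot_atTop.comp hℓ_lim)
    obtain ⟨D, hD⟩ := h1.bddAbove_range
    exact ⟨D, fun n => hD ⟨n, rfl⟩⟩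
  have hD0 : 0 ≤ D := (inv_nonneg.2 (abs_nonneg _)).trans (hD 0)
  set F : ℕ → ℝ → ℂ := fun n t =>
    LSeries.term a (c + t * I) n * (x : ℂ) ^ ((c : ℂ) + t * I) / (c + t * I) with hF
  have hxc : (x : ℂ) ≠ 0 := by exact_mod_cast hx.ne'
  have hF0 : ∀ t, F 0 t = 0 := fun t => by simp [hF]
  have hFn : ∀ n, n ≠ 0 → ∀ t : ℝ,
      F n t = a n * (Complex.exp ((c + t * I) * ℓ n) / (c + t * I)) := fun n hn t => by
    have hnc : (n : ℂ) ≠ 0 := by exact_mod_cast hn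
    simp only [hF, hℓ, LSeries.term_of_ne_zero hn]
    rw [cpow_def_of_ne_zero hxc, cpow_def_of_ne_zero hnc, ofReal_sub, mul_sub, Complex.exp_sub,
      ← ofReal_log hx.le, ← natCast_log, mul_comm (c + t * I : ℂ) (Real.log x),
      mul_comm (c + t * I : ℂ) (Real.log n)]
    have := Complex.exp_ne_zero ((Real.log n : ℂ) * (c + t * I))
    have := add_mul_I_ne_zero (t := t) hc0
    field_simp
  have hterm : ∀ n (t : ℝ), ‖LSeries.term a (c + t * I) n‖ = ‖LSeries.term a c n‖ := fun n t => by
    rw [LSeries.norm_term_eq, LSeries.norm_term_eq]; simp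
  have hxn : ∀ t : ℝ, ‖(x : ℂ) ^ ((c : ℂ) + t * I)‖ = x ^ c := fun t => by
    rw [norm_cpow_eq_rpow_re_of_pos hx]; simp
  have hFcont : ∀ n, Continuous (F n) := fun n => by
    rcases eq_or_ne n 0 with rfl | hn
    · exact (continuous_const (y := (0 : ℂ))).congr fun t => (hF0 t).symm
    · refine Continuous.congr ?_ fun t => (hFn n hn t).symm
      exact continuous_const.mul (Continuous.div₀ (by fun_prop) (by fun_prop)
        fun t => add_mul_I_ne_zero hc0)
  have hFle : ∀ n t, ‖F n t‖ ≤ ‖LSeries.term a c n‖ * x ^ c := fun n t => by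
    simp only [hF, norm_div, norm_mul, hterm, hxn]
    refine div_le_self (by positivity) ?_
    refine le_trans ?_ (abs_re_le_norm _)
    simpa using hc.trans (le_abs_self c)
  have hswap : ∀ U : ℝ, ∫ t in (-U)..U,
      LSeries a (c + t * I) * (x : ℂ) ^ ((c : ℂ) + t * I) / (c + t * I)
        = ∑' n, ∫ t in (-U)..U, F n t := fun U => by
    refine (HasSum.tsum_eq ?_).symm
    refine intervalIntegral.hasSum_integral_of_dominated_convergence
      (fun n _ => ‖LSeries.term a c n‖ * x ^ c) (fun n => (hFcont n).aestronglyMeasurable)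
      (fun n => Eventually.of_forall fun t _ => hFle n t)
      (Eventually.of_forall fun t _ => ha.norm.mul_right _) intervalIntegrable_const
      (Eventually.of_forall fun t _ => ?_)
    have hst : LSeriesSummable a (c + t * I) :=
      ha.norm.of_norm_bounded fun n => (hterm n t).le
    exact (hst.hasSum.mul_right _).div_const _
  simp_rw [hswap]
  have hlim : (2 * π * ∑ n ∈ Finset.Icc 1 ⌊x⌋₊, a n : ℂ)
      = ∑' n, if n ∈ Finset.Icc 1 ⌊x⌋₊ then 2 * π * a n else 0 := by
    rw [Finset.mul_sum, tsum_eq_sum (s := Finset.Icc 1 ⌊x⌋₊) fun n hn => if_neg hn]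
    exact Finset.sum_congr rfl fun n hn => (if_pos hn).symm
  have hint : ∀ n, n ≠ 0 → ∀ U : ℝ, ∫ t in (-U)..U, F n t
      = a n * ∫ t in (-U)..U, Complex.exp ((c + t * I) * ℓ n) / (c + t * I) := fun n hn U => by
    rw [← intervalIntegral.integral_const_mul]
    exact intervalIntegral.integral_congr fun t _ => hFn n hn t
  have hℓ0 : ∀ n, n ≠ 0 → ℓ n ≠ 0 := fun n hn h => by
    have hn0 : (0 : ℝ) < n := by exact_mod_cast Nat.pos_of_ne_zero hn
    exact hxZ n (Real.log_injOn_pos hn0 hx (sub_eq_zero.1 h).symm)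
  rw [hlim]
  refine tendsto_tsum_of_dominated_convergence
    (bound := fun n => ‖LSeries.term a c n‖ * (x ^ c * ((2 + π) * D)))
    (ha.norm.mul_right _) (fun n => ?_) ?_
  · rcases eq_or_ne n 0 with rfl | hn
    · simp [hF0]
    have hn0 : (0 : ℝ) < n := by exact_mod_cast Nat.pos_of_ne_zero hn
    simp_rw [hint n hn]
    split_ifs with hmem
    · rw [mul_comm]
      refine (tendsto_perronKernel_of_pos hc ?_).const_mul _
      have : (n : ℝ) ≤ x := (Nat.le_floor_iff hx.le).1 (Finset.mem_Icc.1 hmem).2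
      exact sub_pos.2 (Real.log_lt_log hn0 (lt_of_le_of_ne this (hxZ n)))
    · rw [← mul_zero (a n)]
      refine (tendsto_perronKernel_of_neg hc ?_).const_mul _
      have : x < n := by
        by_contra! h
        exact hmem (Finset.mem_Icc.2 ⟨Nat.one_le_iff_ne_zero.2 hn, Nat.le_floor h⟩)
      exact sub_neg.2 (Real.log_lt_log hx this)
  · filter_upwards [eventually_ge_atTop 0] with U hU n
    rcases eq_or_ne n 0 with rfl | hn
    · simp [hF0]
    have hn0 : (0 : ℝ) < n := by exact_mod_cast Nat.pos_of_ne_zero hn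
    rw [hint n hn, norm_mul]
    have hexp : ‖a n‖ * Real.exp (c * ℓ n) = ‖LSeries.term a c n‖ * x ^ c := by
      rw [LSeries.norm_term_eq, if_neg hn, ofReal_re, Real.rpow_def_of_pos hx,
        Real.rpow_def_of_pos hn0]
      simp only [hℓ]
      rw [mul_sub, Real.exp_sub, mul_comm c, mul_comm c]
      ring
    calc _ ≤ ‖a n‖ * (Real.exp (c * ℓ n) * ((2 + π) / |ℓ n|)) := by
          gcongr; exact norm_perronKernel_le hc (hℓ0 n hn) hU
      _ = ‖LSeries.term a c n‖ * (x ^ c * ((2 + π) * |ℓ n|⁻¹)) := by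
          rw [← mul_assoc, hexp]; ring
      _ ≤ _ := by gcongr; exact hD n

/-- The integrand `-(ζ'/ζ)(s) ζ(s - α) xˢ / s` of the Perron integral. -/
noncomputable def perronIntegrand (α x : ℝ) (s : ℂ) : ℂ :=
  -logDerivZeta s * riemannZeta (s - α) * (x : ℂ) ^ s / s

lemma term_natCast_cpow (α : ℝ) (s : ℂ) (n : ℕ) :
    LSeries.term (fun n => ((n : ℂ) ^ (α : ℂ))) s n = LSeries.term 1 (s - α) n := by
  rcases eq_or_ne n 0 with rfl | hn
  · simp
  have hnc : (n : ℂ) ≠ 0 := by exact_mod_cast hn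
  rw [LSeries.term_of_ne_zero hn, LSeries.term_of_ne_zero hn, cpow_sub _ _ hnc, Pi.one_apply,
    one_div_div]

lemma tendsto_integral_perronIntegrand_two {α x : ℝ} (hα : α < 1) (hx : 0 < x)
    (hxZ : ∀ n : ℕ, (n : ℝ) ≠ x) :
    Tendsto (fun U : ℝ => ∫ t in (-U)..U, perronIntegrand α x ((2 : ℝ) + t * I)) atTop
      (𝓝 (2 * π * (fAlpha α x : ℂ))) := by
  set Λ' : ℕ → ℂ := fun n => (ArithmeticFunction.vonMangoldt n : ℂ)
  set p : ℕ → ℂ := fun n => (n : ℂ) ^ (α : ℂ)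
  have hΛ : ∀ s : ℂ, 1 < s.re → LSeriesSummable Λ' s := fun s hs =>
    ArithmeticFunction.LSeriesSummable_vonMangoldt hs
  have hp : ∀ s : ℂ, 1 + α < s.re → LSeriesSummable p s := fun s hs =>
    (summable_congr (term_natCast_cpow α s)).2
      ((LSeriesSummable_one_iff (s := s - α)).2 (by simp; linarith))
  have hpz : ∀ s : ℂ, 1 + α < s.re → LSeries p s = riemannZeta (s - α) := fun s hs => by
    rw [← LSeries_one_eq_riemannZeta (by simp; linarith)]
    exact tsum_congr (term_natCast_cpow α s)
  have h1 : LSeriesSummable (LSeries.convolution Λ' p) (2 : ℝ) :=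
    (hΛ _ (by simp)).convolution (hp _ (by simp; linarith))
  have key := tendsto_vertical_integral_LSeries one_le_two h1 hx hxZ
  have hsum : ∑ n ∈ Finset.Icc 1 ⌊x⌋₊, LSeries.convolution Λ' p n = (fAlpha α x : ℂ) := by
    rw [fAlpha]
    push_cast
    refine Finset.sum_congr rfl fun n _ => ?_
    rw [LSeries.convolution_def]
    simp only
    rw [Nat.sum_divisorsAntidiagonal' (f := fun a b => Λ' a * p b)]
    refine Finset.sum_congr rfl fun d _ => ?_
    simp only [Λ', p]
    rw [ofReal_cpow (Nat.cast_nonneg d), ofReal_natCast]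
  rw [hsum] at key
  refine key.congr fun U => intervalIntegral.integral_congr fun t _ => ?_
  have hre : (((2 : ℝ) : ℂ) + t * I).re = 2 := by simp
  simp only [perronIntegrand, logDerivZeta]
  rw [LSeries_convolution' (hΛ _ (by rw [hre]; norm_num)) (hp _ (by rw [hre]; linarith)),
    hpz _ (by rw [hre]; linarith),
    ArithmeticFunction.LSeries_vonMangoldt_eq_deriv_riemannZeta_div (by rw [hre]; norm_num), neg_div]

lemma logDerivZeta_eq {s : ℂ} (hs : s ≠ 1) (h0 : riemannZeta₁ s ≠ 0) :
    logDerivZeta s = deriv riemannZeta₁ s / riemannZeta₁ s - (s - 1)⁻¹ := by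
  rw [logDerivZeta, deriv_riemannZeta_eq_neg_inv_sub_sq_mul_add hs, riemannZeta_eq_inv_sub_mul hs]
  have := sub_ne_zero.2 hs
  field_simp
  ring

/-- The function `(s - 1) (s - 1 - α) G(s)`, where `G` is the integrand of the Perron integral,
without its removable singularities at `1` and `1 + α`. -/
noncomputable def perronNumerator (α x : ℝ) (s : ℂ) : ℂ :=
  (1 - (s - 1) * (deriv riemannZeta₁ s / riemannZeta₁ s)) * riemannZeta₁ (s - α) * (x : ℂ) ^ s / s

lemma differentiableOn_perronNumerator (hRH : RiemannHypothesis) (α : ℝ) {x : ℝ} (hx : 0 < x) :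
    DifferentiableOn ℂ (perronNumerator α x) {s | 1 / 2 < s.re} := by
  intro s hs
  have hs' : 1 / 2 < s.re := hs
  have hs0 : s ≠ 0 := by rintro rfl; norm_num at hs'
  have hxc : (x : ℂ) ≠ 0 := by exact_mod_cast hx.ne'
  have h1 := (differentiable_riemannZeta₁.deriv s).div (differentiable_riemannZeta₁ s)
    (riemannZeta₁_ne_zero_of_half_lt_re hRH hs')
  have h2 : DifferentiableAt ℂ (fun s => riemannZeta₁ (s - α)) s :=
    (differentiable_riemannZeta₁ _).comp s (differentiableAt_id.sub_const _)
  have h3 : DifferentiableAt ℂ (fun s => (x : ℂ) ^ s) s :=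
    differentiableAt_id.const_cpow (.inl hxc)
  exact ((((((differentiableAt_id.sub_const 1).mul h1).const_sub 1).mul h2).mul h3).div
    differentiableAt_id hs0).differentiableWithinAt

lemma perronIntegrand_eq {α x : ℝ} {s : ℂ} (h1 : s ≠ 1) (hα : s ≠ 1 + α)
    (h0 : riemannZeta₁ s ≠ 0) :
    perronIntegrand α x s = perronNumerator α x s * ((s - 1)⁻¹ * (s - (1 + α))⁻¹) := by
  have hα' : s - α ≠ 1 := fun h => hα (by linear_combination h)
  rw [perronIntegrand, perronNumerator, logDerivZeta_eq h1 h0, riemannZeta_eq_inv_sub_mul hα',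
    show s - α - 1 = s - (1 + α) by ring]
  have := sub_ne_zero.2 h1
  have := sub_ne_zero.2 hα
  field_simp
  ring

lemma perronNumerator_one (α x : ℝ) (hα : α ≠ 0) :
    perronNumerator α x 1 = -α * (riemannZeta (1 - α) * x) := by
  have h1 : (1 : ℂ) - α ≠ 1 := fun h => hα (by simpa using h)
  rw [perronNumerator, riemannZeta₁_eq h1]
  simp [mul_assoc]

lemma perronNumerator_one_add (hRH : RiemannHypothesis) {α : ℝ} (hα : 0 < α) (x : ℝ) :
    perronNumerator α x (1 + α)
      = α * (-(1 / (1 + α)) * logDerivZeta (1 + α) * (x : ℂ) ^ ((1 : ℂ) + α)) := by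
  have hαc : (α : ℂ) ≠ 0 := by exact_mod_cast hα.ne'
  have h1 : (1 : ℂ) + α ≠ 1 := by simpa using hαc
  have h2 : (1 : ℂ) + α ≠ 0 := by exact_mod_cast (by positivity : 1 + α ≠ 0)
  rw [perronNumerator, logDerivZeta_eq h1
    (riemannZeta₁_ne_zero_of_half_lt_re hRH (by simp; linarith)), add_sub_cancel_right,
    add_sub_cancel_left, riemannZeta₁_one]
  field_simp
  ring

lemma tendsto_integral_perronIntegrand_sub (hRH : RiemannHypothesis) {α x : ℝ} (hα0 : 0 < α)
    (hα : α < 1 / 2) (hx : 1 < x) :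
    Tendsto (fun U : ℝ => (∫ t in (-U)..U, perronIntegrand α x ((2 : ℝ) + t * I))
        - ∫ t in (-U)..U, perronIntegrand α x ((1 / 2 + α : ℝ) + t * I)) atTop
      (𝓝 (2 * π * (-(1 / (1 + α)) * logDerivZeta (1 + α) * (x : ℂ) ^ ((1 : ℂ) + α)
        + riemannZeta (1 - α) * x))) := by
  have hx0 : 0 < x := by linarith
  have hαc : (α : ℂ) ≠ 0 := by exact_mod_cast hα0.ne'
  set H := perronNumerator α x with hH
  have hHd := differentiableOn_perronNumerator hRH α hx0
  have hUo : IsOpen {s : ℂ | 1 / 2 < s.re} := isOpen_lt continuous_const continuous_re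
  have hne : (1 : ℝ) ≠ 1 + α := by linarith
  obtain ⟨A, hA0, hA⟩ := exists_norm_logDeriv_riemannZeta₁_le hRH hα0 hα
  obtain ⟨C, hC0, hC⟩ := exists_norm_riemannZeta₁_le
  have hdslope : ∀ p : ℂ, 1 / 2 < p.re → ∀ s : ℂ, 1 / 2 < s.re →
      DifferentiableAt ℂ (dslope H p) s := fun p hp s hs =>
    ((Complex.differentiableOn_dslope (hUo.mem_nhds hp)).2 hHd).differentiableAt (hUo.mem_nhds hs)
  have hdiv : ∀ p s : ℂ, s ≠ p → H s * (s - p)⁻¹ = dslope H p s + H p * (s - p)⁻¹ :=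
    fun p s hsp => by
      rw [dslope_of_ne _ hsp, slope_def_field]
      ring
  have key := tendsto_vertical_integral_sub_of_poles (G := perronIntegrand α x)
    (a := 1 / 2 + α) (b := 2) (by linarith) {1, 1 + α}
    (fun p => if p = 1 then -(H 1 / α) else H (1 + α) / α)
    (g := fun s => (α : ℂ)⁻¹ * (dslope H (1 + α) s - dslope H 1 s))
    (B := fun u => (1 + A) * (1 + C) * x ^ 2 * 5 * (u + 4) ^ (-(1 / 16) : ℝ)) ?_ ?_ ?_ ?_ ?_
  · convert key using 3
    rw [Finset.sum_pair hne, if_pos rfl, if_neg hne.symm, hH, perronNumerator_one α x hα0.ne',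
      perronNumerator_one_add hRH hα0]
    field_simp
    ring
  · intro p hp
    rcases Finset.mem_insert.1 hp with rfl | hp
    · constructor <;> linarith
    · rw [Finset.mem_singleton.1 hp]
      constructor <;> linarith
  · intro s hs _
    have hs' : 1 / 2 < s.re := by linarith
    exact ((hdslope _ (by simp; linarith) s hs').sub (hdslope _ (by norm_num) s hs')).const_mul _
  · intro s hs _ hsS
    have hs1 : s ≠ 1 := by simpa using hsS 1 (by simp)
    have hsα : s ≠ 1 + α := by simpa using hsS (1 + α) (by simp)
    rw [perronIntegrand_eq hs1 hsα (riemannZeta₁_ne_zero_of_half_lt_re hRH (by linarith)),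
      Finset.sum_pair hne, if_pos rfl, if_neg hne.symm]
    have h1 := hdiv 1 s hs1
    have h2 := hdiv (1 + α) s hsα
    have h3 : (s - 1)⁻¹ * (s - (1 + α))⁻¹ = (α : ℂ)⁻¹ * ((s - (1 + α))⁻¹ - (s - 1)⁻¹) := by
      have := sub_ne_zero.2 hs1
      have := sub_ne_zero.2 hsα
      field_simp
      ring
    rw [h3]
    push_cast
    linear_combination (α : ℂ)⁻¹ * (h2 - h1)
  · have h1 : Tendsto (fun u : ℝ => (u + 4) ^ (-(1 / 16) : ℝ)) atTop (𝓝 0) :=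
      (tendsto_rpow_neg_atTop (by norm_num : (0 : ℝ) < 1 / 16)).comp
        (tendsto_atTop_add_const_right _ 4 tendsto_id)
    simpa using h1.const_mul ((1 + A) * (1 + C) * x ^ 2 * 5)
  · intro σ t hσ hσ2 ht
    have ht0 : t ≠ 0 := by rintro rfl; norm_num at ht
    set T := |t| + 4 with hT
    have hT1 : 1 ≤ T := by linarith
    have hT0 : 0 < T := by linarith
    have hinv : ∀ u : ℝ, ‖((u : ℂ) + t * I)⁻¹‖ ≤ |t|⁻¹ := fun u => norm_inv_add_mul_I_le u t ht0
    have htinv : |t|⁻¹ ≤ 1 := inv_le_one_of_one_le₀ ht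
    set s : ℂ := σ + t * I with hs
    have him : s.im = t := by simp [hs]
    have hre : s.re = σ := by simp [hs]
    have hs1 : s ≠ 1 := fun h => ht0 (by simpa [him] using congrArg im h)
    have hsα : s - α ≠ 1 := fun h => ht0 (by simpa [him] using congrArg im h)
    have hld : ‖logDerivZeta s‖ ≤ (1 + A) * T ^ (1 / 16 : ℝ) := by
      rw [logDerivZeta_eq hs1 (riemannZeta₁_ne_zero_of_half_lt_re hRH (by linarith))]
      refine (norm_sub_le _ _).trans ?_
      have h1 := hinv (σ - 1)
      rw [show ((σ - 1 : ℝ) : ℂ) + t * I = s - 1 by rw [hs]; push_cast; ring] at h1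
      have h2 := hA σ t hσ hσ2
      have h3 := Real.one_le_rpow hT1 (by norm_num : (0 : ℝ) ≤ 1 / 16)
      linarith
    have hz : ‖riemannZeta (s - α)‖ ≤ (1 + C) * T ^ (7 / 8 : ℝ) := by
      rw [riemannZeta_eq_inv_sub_mul hsα, norm_mul]
      have h1 := hinv (σ - α - 1)
      rw [show ((σ - α - 1 : ℝ) : ℂ) + t * I = s - α - 1 by rw [hs]; push_cast; ring] at h1
      have h2 := hC (s - α) (by simp [hre]; linarith)
      have h3 : ‖s - α‖ ≤ T := by
        rw [show s - α = ((σ - α : ℝ) : ℂ) + t * I by rw [hs]; push_cast; ring]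
        refine (norm_add_le _ _).trans ?_
        rw [norm_mul, norm_I, mul_one, norm_real, norm_real, Real.norm_eq_abs, Real.norm_eq_abs,
          abs_of_nonneg (by linarith)]
        linarith
      have h4 := Real.one_le_rpow hT1 (by norm_num : (0 : ℝ) ≤ 7 / 8)
      have h5 : ‖(s - α - 1)⁻¹‖ * ‖s - α - 1‖ = 1 := by
        rw [← norm_mul, inv_mul_cancel₀ (sub_ne_zero.2 hsα), norm_one]
      calc _ ≤ ‖(s - α - 1)⁻¹‖ * (1 + C * ‖s - α - 1‖ * ‖s - α‖ ^ (7 / 8 : ℝ)) := by gcongr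
        _ = ‖(s - α - 1)⁻¹‖ + C * ‖s - α‖ ^ (7 / 8 : ℝ) := by
            linear_combination (C * ‖s - α‖ ^ (7 / 8 : ℝ)) * h5
        _ ≤ 1 + C * T ^ (7 / 8 : ℝ) := by
            gcongr
            exact h1.trans htinv
        _ ≤ _ := by linarith
    have hxs : ‖(x : ℂ) ^ s‖ ≤ x ^ 2 := by
      rw [norm_cpow_eq_rpow_re_of_pos hx0, hre, ← Real.rpow_natCast]
      exact Real.rpow_le_rpow_of_exponent_le hx.le (by exact_mod_cast hσ2)
    have hsinv : ‖s⁻¹‖ ≤ 5 * T⁻¹ := by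
      refine (hinv σ).trans ?_
      rw [← div_eq_mul_inv, inv_eq_one_div, div_le_div_iff₀ (by linarith) hT0]
      linarith
    rw [perronIntegrand, div_eq_mul_inv, norm_mul, norm_mul, norm_mul, norm_neg]
    calc _ ≤ (1 + A) * T ^ (1 / 16 : ℝ) * ((1 + C) * T ^ (7 / 8 : ℝ)) * x ^ 2 * (5 * T⁻¹) := by
          gcongr
      _ = (1 + A) * (1 + C) * x ^ 2 * 5 * (T ^ (1 / 16 : ℝ) * T ^ (7 / 8 : ℝ) * T ^ (-1 : ℝ)) := by
          rw [Real.rpow_neg_one]; ring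
      _ = _ := by
          rw [← Real.rpow_add hT0, ← Real.rpow_add hT0]
          norm_num

lemma logDerivZeta_conj (s : ℂ) :
    logDerivZeta (starRingEnd ℂ s) = starRingEnd ℂ (logDerivZeta s) := by
  have h : starRingEnd ℂ ∘ riemannZeta ∘ starRingEnd ℂ = riemannZeta := by
    ext z; simp [riemannZeta_conj]
  have h1 := congrFun (deriv_conj_conj (f := riemannZeta)) (starRingEnd ℂ s)
  rw [h] at h1
  rw [logDerivZeta, logDerivZeta, h1, riemannZeta_conj, map_div₀]
  simp

lemma ofReal_MAlpha {α x : ℝ} (hx : 0 < x) :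
    (MAlpha α x : ℂ) = -(1 / (1 + α)) * logDerivZeta (1 + α) * (x : ℂ) ^ ((1 : ℂ) + α)
      + riemannZeta (1 - α) * x := by
  have h1 : (((riemannZeta (1 - α)).re : ℝ) : ℂ) = riemannZeta (1 - α) :=
    conj_eq_iff_re.1 (by rw [← riemannZeta_conj]; simp)
  have h2 : (((-(1 / (1 + α)) * logDerivZeta (1 + α) : ℂ).re : ℝ) : ℂ)
      = -(1 / (1 + α)) * logDerivZeta (1 + α) :=
    conj_eq_iff_re.1 (by simp [← logDerivZeta_conj])
  rw [MAlpha, ofReal_add, ofReal_mul, ofReal_mul, h1, h2, ofReal_cpow hx.le]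
  push_cast
  rfl

/-- The Perron-formula identity (4.1): under RH, for `0 < α < 1/2` and non-integer `x > 1`,
`f_α(x) - M_α(x)
  = (1/2π) ∫_{-∞}^{∞} -(ζ'/ζ)(1/2+α+it) ζ(1/2+it) x^{1/2+α+it}/(1/2+α+it) dt`,
the integral being the limit of symmetric truncations. -/
theorem perron_identity (hRH : RiemannHypothesis) (α : ℝ) (hα0 : 0 < α) (hα : α < 1/2)
    (x : ℝ) (hx : 1 < x) (hxZ : ∀ n : ℕ, (n : ℝ) ≠ x) :
    ∃ L : ℂ, Filter.Tendsto
        (fun U : ℝ => ∫ t in (-U)..U,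
          -(logDerivZeta (1/2 + (α:ℂ) + t * Complex.I))
            * riemannZeta (1/2 + t * Complex.I)
            * (x:ℂ) ^ (1/2 + (α:ℂ) + t * Complex.I)
            / (1/2 + (α:ℂ) + t * Complex.I))
        Filter.atTop (nhds L)
      ∧ ((fAlpha α x - MAlpha α x : ℝ) : ℂ) = ((1/(2*π) : ℝ) : ℂ) * L := by
  have hx0 : 0 < x := by linarith
  have h1 := tendsto_integral_perronIntegrand_two (α := α) (by linarith) hx0 hxZ
  have h2 := tendsto_integral_perronIntegrand_sub hRH hα0 hα hx
  rw [← ofReal_MAlpha hx0] at h2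
  refine ⟨2 * π * (fAlpha α x : ℂ) - 2 * π * (MAlpha α x : ℂ), (h1.sub h2).congr fun U => ?_, ?_⟩
  · rw [sub_sub_cancel]
    refine intervalIntegral.integral_congr fun t _ => ?_
    simp only [perronIntegrand]
    rw [show ((1 / 2 + α : ℝ) : ℂ) + t * I = 1 / 2 + α + t * I by push_cast; ring,
      show (1 / 2 + α + t * I - α : ℂ) = 1 / 2 + t * I by ring]
  · have : (π : ℂ) ≠ 0 := by exact_mod_cast Real.pi_ne_zero
    push_cast
    field_simp
end

section
/- There exist constants C > 0, δ > 0 and T₀ > 2 such that for all T ≥ T₀ and all real a with 0 < a ≤ δ the following holds: defining g_a(n) := Σ_{d·m = n} (−Λ(d)·d^{−a/log T})·τ(m) (sum over factorizations of n into positive integers d, m), one has | Σ_{n ≤ T/(2π)} g_a(n) − (T(log T)²/(2π)) · (1 − a − e^{−a})/a² | ≤ C · T log T. -/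
open Real

section

open Finset
open ArithmeticFunction hiding log

lemma sum_inv_eq_harmonic (n : ℕ) : ∑ d ∈ Ioc 0 n, (d : ℝ)⁻¹ = (harmonic n : ℝ) := by
  rw [harmonic_eq_sum_Icc, ← Icc_succ_left_eq_Ioc]
  push_cast
  rfl

/-- The summatory function of the number of divisors is `y log y + O(y)`. -/
lemma abs_sum_card_divisors_sub_le {y : ℝ} (hy : 1 ≤ y) :
    |∑ m ∈ Ioc 0 ⌊y⌋₊, (m.divisors.card : ℝ) - y * log y| ≤ y := by
  have hsum : ∑ m ∈ Ioc 0 ⌊y⌋₊, (m.divisors.card : ℝ)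
      = ∑ m ∈ Ioc 0 ⌊y⌋₊, ((⌊y / m⌋₊ : ℕ) : ℝ) := by
    have h := sum_Ioc_sigma0_eq_sum_div ⌊y⌋₊
    simp only [sigma_zero_apply] at h
    simp only [Nat.floor_div_natCast]
    exact_mod_cast h
  have hharm : ∑ m ∈ Ioc 0 ⌊y⌋₊, y / (m : ℝ) = y * (harmonic ⌊y⌋₊ : ℝ) := by
    simp only [div_eq_mul_inv, ← mul_sum, sum_inv_eq_harmonic]
  have hy0 : 0 ≤ y := by linarith
  have hup : ∑ m ∈ Ioc 0 ⌊y⌋₊, ((⌊y / m⌋₊ : ℕ) : ℝ) ≤ ∑ m ∈ Ioc 0 ⌊y⌋₊, y / (m : ℝ) :=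
    sum_le_sum fun m _ ↦ Nat.floor_le (by positivity)
  have hlow : ∑ m ∈ Ioc 0 ⌊y⌋₊, (y / (m : ℝ) - 1) ≤ ∑ m ∈ Ioc 0 ⌊y⌋₊, ((⌊y / m⌋₊ : ℕ) : ℝ) :=
    sum_le_sum fun m _ ↦ (Nat.sub_one_lt_floor _).le
  rw [sum_sub_distrib, hharm] at hlow
  simp only [sum_const, Nat.card_Ioc, tsub_zero, nsmul_eq_mul, mul_one] at hlow
  have h1 := mul_le_mul_of_nonneg_left (log_le_harmonic_floor y hy0) hy0
  have h2 := mul_le_mul_of_nonneg_left (harmonic_floor_le_one_add_log y hy) hy0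
  have h3 := Nat.floor_le hy0
  rw [hsum, abs_le]
  constructor <;> linarith

lemma log_factorial_eq_sum_vonMangoldt (n : ℕ) :
    log n.factorial = ∑ d ∈ Ioc 0 n, Λ d * ((n / d : ℕ) : ℝ) := by
  rw [← sum_Ioc_mul_zeta_eq_sum, vonMangoldt_mul_zeta]
  induction n with
  | zero => simp
  | succ n ih =>
    rw [Nat.factorial_succ, Nat.cast_mul, log_mul (by positivity) (by positivity), ih,
      sum_Ioc_succ_top (by positivity), ArithmeticFunction.log_apply, add_comm]

/-- Mertens' first theorem, with the harmonic sum in place of the logarithm. -/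
lemma abs_sum_vonMangoldt_div_sub_inv_le (n : ℕ) :
    |∑ d ∈ Ioc 0 n, (Λ d / d - (d : ℝ)⁻¹)| ≤ log 4 + 4 := by
  have hlog4 : 0 ≤ log 4 := log_nonneg (by norm_num)
  rcases Nat.eq_zero_or_pos n with rfl | hn
  · simp; linarith
  have hn0 : (0 : ℝ) < n := by exact_mod_cast hn
  have hh1 := log_le_harmonic_floor n hn0.le
  have hh2 := harmonic_floor_le_one_add_log n (by exact_mod_cast hn)
  rw [Nat.floor_natCast] at hh1 hh2
  have hfl : log n.factorial ≤ n * log n := by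
    rw [← log_pow]
    exact log_le_log (by positivity) (by exact_mod_cast n.factorial_le_pow)
  have hfl' : n * log n - n ≤ log n.factorial := by
    have h := Stirling.le_log_factorial_stirling hn.ne'
    have h1 : 0 ≤ log n := log_nonneg (by exact_mod_cast hn)
    have h2 : 0 ≤ log (2 * π) := log_nonneg (by linarith [pi_gt_three])
    linarith
  have hup : log n.factorial ≤ n * ∑ d ∈ Ioc 0 n, Λ d / d := by
    rw [log_factorial_eq_sum_vonMangoldt, mul_sum]
    refine sum_le_sum fun d _ ↦ ?_
    rw [show (n : ℝ) * (Λ d / d) = Λ d * (n / d) by ring]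
    exact mul_le_mul_of_nonneg_left Nat.cast_div_le vonMangoldt_nonneg
  have hlow : n * ∑ d ∈ Ioc 0 n, Λ d / d - Chebyshev.psi n ≤ log n.factorial := by
    rw [log_factorial_eq_sum_vonMangoldt, mul_sum, Chebyshev.psi, Nat.floor_natCast,
      ← sum_sub_distrib]
    refine sum_le_sum fun d _ ↦ ?_
    rw [show (n : ℝ) * (Λ d / d) - Λ d = Λ d * (n / d - 1) by ring, ← Nat.floor_div_eq_div (K := ℝ)]
    exact mul_le_mul_of_nonneg_left (Nat.sub_one_lt_floor _).le vonMangoldt_nonneg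
  have hpsi := Chebyshev.psi_le_const_mul_self hn0.le
  have hA : ∑ d ∈ Ioc 0 n, Λ d / d ≤ log n + (log 4 + 4) := by
    refine le_of_mul_le_mul_left ?_ hn0
    linarith
  have hB : log n - 1 ≤ ∑ d ∈ Ioc 0 n, Λ d / d := by
    refine le_of_mul_le_mul_left ?_ hn0
    linarith
  rw [sum_sub_distrib, sum_inv_eq_harmonic, abs_le]
  constructor <;> linarith

/-- Abel's inequality: bounded partial sums against a nonnegative antitone weight. -/
lemma abs_sum_mul_le_of_antitone {c f : ℕ → ℝ} {B : ℝ} {N : ℕ} (hN : 1 ≤ N)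
    (hc : ∀ n, |∑ d ∈ Ioc 0 n, c d| ≤ B) (hf : ∀ n, 1 ≤ n → n < N → f (n + 1) ≤ f n)
    (hf0 : 0 ≤ f N) : |∑ d ∈ Ioc 0 N, c d * f d| ≤ B * f 1 := by
  have key : ∀ M, 1 ≤ M → M ≤ N →
      |∑ d ∈ Ioc 0 M, c d * f d - f M * ∑ d ∈ Ioc 0 M, c d| ≤ B * (f 1 - f M) := by
    intro M hM
    induction M, hM using Nat.le_induction with
    | base => intro _; simp [mul_comm]
    | succ n hn ih =>
      intro h
      have h1 := ih (by omega)
      have h2 : |(f n - f (n + 1)) * ∑ d ∈ Ioc 0 n, c d| ≤ (f n - f (n + 1)) * B := by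
        have h3 : 0 ≤ f n - f (n + 1) := sub_nonneg.2 (hf n hn (by omega))
        rw [abs_mul, abs_of_nonneg h3]
        exact mul_le_mul_of_nonneg_left (hc n) h3
      rw [sum_Ioc_succ_top (by positivity), sum_Ioc_succ_top (by positivity)]
      rw [abs_le] at h1 h2 ⊢
      constructor <;> linarith
  have h1 := key N hN le_rfl
  have h2 : |f N * ∑ d ∈ Ioc 0 N, c d| ≤ f N * B := by
    rw [abs_mul, abs_of_nonneg hf0]
    exact mul_le_mul_of_nonneg_left (hc N) hf0
  rw [abs_le] at h1 h2 ⊢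
  constructor <;> linarith

/-- Comparison of a sum of values of an antitone nonnegative function with the increment of an
antiderivative. -/
lemma abs_sum_sub_antideriv_le {P φ : ℝ → ℝ} {x : ℝ} (hx : 1 ≤ x)
    (hP : ∀ u, 1 ≤ u → HasDerivAt P (φ u) u) (hφ : AntitoneOn φ (Set.Icc 1 x)) (hφ0 : 0 ≤ φ x) :
    |∑ d ∈ Ioc 0 ⌊x⌋₊, φ d - (P x - P 1)| ≤ φ 1 := by
  have hincr : ∀ a b, 1 ≤ a → a ≤ b → b ≤ x →
      φ b * (b - a) ≤ P b - P a ∧ P b - P a ≤ φ a * (b - a) := by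
    intro a b ha hab hb
    rcases hab.eq_or_lt with rfl | hlt
    · simp
    obtain ⟨c, hc, hcs⟩ := exists_hasDerivAt_eq_slope P φ hlt
      (fun u hu ↦ (hP u (ha.trans hu.1)).continuousAt.continuousWithinAt)
      (fun u hu ↦ hP u (ha.trans hu.1.le))
    have hpos : 0 < b - a := sub_pos.2 hlt
    rw [eq_div_iff hpos.ne'] at hcs
    rw [← hcs]
    have h1 : φ b ≤ φ c := hφ ⟨ha.trans hc.1.le, hc.2.le.trans hb⟩ ⟨ha.trans hab, hb⟩ hc.2.le
    have h2 : φ c ≤ φ a := hφ ⟨ha, hab.trans hb⟩ ⟨ha.trans hc.1.le, hc.2.le.trans hb⟩ hc.1.le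
    exact ⟨mul_le_mul_of_nonneg_right h1 hpos.le, mul_le_mul_of_nonneg_right h2 hpos.le⟩
  have key : ∀ M : ℕ, 1 ≤ M → (M : ℝ) ≤ x →
      P M - P 1 ≤ ∑ d ∈ Ioc 0 M, φ d - φ M ∧ ∑ d ∈ Ioc 0 M, φ d ≤ P M - P 1 + φ 1 := by
    intro M hM
    induction M, hM using Nat.le_induction with
    | base => intro _; simp
    | succ n hn ih =>
      intro h
      push_cast at h
      have h1 := ih (by linarith)
      have h2 := hincr n (n + 1) (by exact_mod_cast hn) (by linarith) h
      rw [sum_Ioc_succ_top (by positivity)]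
      push_cast
      constructor <;> linarith
  have hN : 1 ≤ ⌊x⌋₊ := Nat.floor_pos.2 hx
  have hNx : (⌊x⌋₊ : ℝ) ≤ x := Nat.floor_le (by linarith)
  have hxN : x < ⌊x⌋₊ + 1 := Nat.lt_floor_add_one x
  have hN1 : (1 : ℝ) ≤ ⌊x⌋₊ := by exact_mod_cast hN
  have h1 := key _ hN hNx
  have h2 := hincr _ x hN1 hNx le_rfl
  have h3 : φ x ≤ φ ⌊x⌋₊ := hφ ⟨hN1, hNx⟩ ⟨hx, le_rfl⟩ hNx
  have h4 : 0 ≤ φ x * (x - ⌊x⌋₊) := mul_nonneg hφ0 (by linarith)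
  have h5 : φ ⌊x⌋₊ * (x - ⌊x⌋₊) ≤ φ ⌊x⌋₊ * 1 :=
    mul_le_mul_of_nonneg_left (by linarith) (hφ0.trans h3)
  rw [abs_le]
  constructor <;> linarith

lemma antitoneOn_rpow_neg_mul_log_sub {s x : ℝ} (hs : 0 < s) :
    AntitoneOn (fun u : ℝ ↦ u ^ (-s) * (log x - log u)) (Set.Icc 1 x) := by
  intro u hu v hv huv
  have hu0 : 0 < u := by linarith [hu.1]
  have h1 : v ^ (-s) ≤ u ^ (-s) := rpow_le_rpow_of_nonpos hu0 huv (by linarith)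
  have h2 : log u ≤ log v := log_le_log hu0 huv
  have h3 : log v ≤ log x := log_le_log (by linarith) hv.2
  exact mul_le_mul h1 (by linarith) (by linarith) (by positivity)

lemma antitoneOn_rpow_neg_mul_log_sub_mul_inv {s x : ℝ} (hs : 0 < s) :
    AntitoneOn (fun u : ℝ ↦ u ^ (-s) * (log x - log u) * u⁻¹) (Set.Icc 1 x) := by
  intro u hu v hv huv
  have hu0 : 0 < u := by linarith [hu.1]
  have hv0 : 0 < v := by linarith
  have h1 := antitoneOn_rpow_neg_mul_log_sub hs hu hv huv
  have h2 : v⁻¹ ≤ u⁻¹ := inv_anti₀ hu0 huv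
  have h3 : log u ≤ log x := log_le_log hu0 hu.2
  exact mul_le_mul h1 h2 (by positivity) (mul_nonneg (by positivity) (by linarith))

lemma hasDerivAt_rpow_neg_mul_antideriv {s L u : ℝ} (hs : 0 < s) (hu : 0 < u) :
    HasDerivAt (fun u : ℝ ↦ u ^ (-s) * ((log u - L) / s + 1 / s ^ 2))
      (u ^ (-s) * (L - log u) * u⁻¹) u := by
  have h1 := hasDerivAt_rpow_const (x := u) (p := -s) (Or.inl hu.ne')
  have h2 := (((hasDerivAt_log hu.ne').sub_const L).div_const s).add_const (1 / s ^ 2)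
  refine (h1.mul h2).congr_deriv ?_
  rw [rpow_sub_one hu.ne']
  field_simp
  ring

/-- Mean value of `Λ(d) d^{-1-s}` against the weight `log (x / d)`. -/
lemma abs_sum_vonMangoldt_rpow_log_sub_le {s x : ℝ} (hs : 0 < s) (hx : 1 ≤ x) :
    |∑ d ∈ Ioc 0 ⌊x⌋₊, Λ d / d * ((d : ℝ) ^ (-s) * (log x - log d))
      - (s * log x - 1 + exp (-(s * log x))) / s ^ 2| ≤ (log 4 + 5) * log x := by
  have hx0 : 0 < x := by linarith
  have hN : 1 ≤ ⌊x⌋₊ := Nat.floor_pos.2 hx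
  have hNx : (⌊x⌋₊ : ℝ) ≤ x := Nat.floor_le hx0.le
  have hA := abs_sum_mul_le_of_antitone (c := fun d ↦ Λ d / d - (d : ℝ)⁻¹)
    (f := fun d ↦ (d : ℝ) ^ (-s) * (log x - log d)) hN
    abs_sum_vonMangoldt_div_sub_inv_le (fun n hn hnN ↦ by
      have h1 : (1 : ℝ) ≤ n := by exact_mod_cast hn
      have h2 : ((n + 1 : ℕ) : ℝ) ≤ x := le_trans (by exact_mod_cast hnN) hNx
      have h3 : (n : ℝ) ≤ (n + 1 : ℕ) := by simp
      exact antitoneOn_rpow_neg_mul_log_sub hs ⟨h1, h3.trans h2⟩ ⟨h1.trans h3, h2⟩ h3)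
    (mul_nonneg (by positivity)
      (sub_nonneg.2 (log_le_log (by exact_mod_cast hN) hNx)))
  have hB := abs_sum_sub_antideriv_le hx
    (fun u hu ↦ hasDerivAt_rpow_neg_mul_antideriv (L := log x) hs (by linarith : 0 < u))
    (antitoneOn_rpow_neg_mul_log_sub_mul_inv hs) (by simp)
  have hP : x ^ (-s) * ((log x - log x) / s + 1 / s ^ 2)
      - (1 : ℝ) ^ (-s) * ((log 1 - log x) / s + 1 / s ^ 2)
      = (s * log x - 1 + exp (-(s * log x))) / s ^ 2 := by
    rw [rpow_def_of_pos hx0, one_rpow, log_one, show log x * -s = -(s * log x) by ring]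
    field_simp
    ring
  have hsplit : ∑ d ∈ Ioc 0 ⌊x⌋₊, Λ d / d * ((d : ℝ) ^ (-s) * (log x - log d))
      = ∑ d ∈ Ioc 0 ⌊x⌋₊, (Λ d / d - (d : ℝ)⁻¹) * ((d : ℝ) ^ (-s) * (log x - log d))
        + ∑ d ∈ Ioc 0 ⌊x⌋₊, (d : ℝ) ^ (-s) * (log x - log d) * (d : ℝ)⁻¹ := by
    rw [← sum_add_distrib]
    exact sum_congr rfl fun d _ ↦ by ring
  simp only [hP] at hB
  simp only [Nat.cast_one, one_rpow, log_one, sub_zero, one_mul, inv_one, mul_one] at hA hB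
  rw [hsplit]
  rw [abs_le] at hA hB ⊢
  constructor <;> linarith

/-- The convolution of `Λ(d) d^{-s}` with the divisor function, summed up to `x`, compared with
its logarithmic main term. -/
lemma abs_sum_vonMangoldt_mul_divisors_sub_le {s x : ℝ} (hs : 0 < s) (hx : 1 ≤ x) :
    |∑ d ∈ Ioc 0 ⌊x⌋₊, Λ d * (d : ℝ) ^ (-s) * ∑ m ∈ Ioc 0 (⌊x⌋₊ / d), (m.divisors.card : ℝ)
      - x * ∑ d ∈ Ioc 0 ⌊x⌋₊, Λ d / d * ((d : ℝ) ^ (-s) * (log x - log d))|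
      ≤ x * (log x + (log 4 + 5)) := by
  have hx0 : 0 < x := by linarith
  rw [mul_sum, ← sum_sub_distrib]
  have hterm : ∀ d ∈ Ioc 0 ⌊x⌋₊,
      |Λ d * (d : ℝ) ^ (-s) * ∑ m ∈ Ioc 0 (⌊x⌋₊ / d), (m.divisors.card : ℝ)
        - x * (Λ d / d * ((d : ℝ) ^ (-s) * (log x - log d)))| ≤ x * (Λ d / d) := by
    intro d hd
    rw [mem_Ioc] at hd
    have hd1 : (1 : ℝ) ≤ d := by exact_mod_cast hd.1
    have hdx : (d : ℝ) ≤ x := (Nat.le_floor_iff hx0.le).1 hd.2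
    have hd0 : (0 : ℝ) < d := by linarith
    have h := abs_sum_card_divisors_sub_le ((one_le_div hd0).2 hdx)
    rw [Nat.floor_div_natCast, log_div hx0.ne' hd0.ne'] at h
    rw [show Λ d * (d : ℝ) ^ (-s) * ∑ m ∈ Ioc 0 (⌊x⌋₊ / d), (m.divisors.card : ℝ)
        - x * (Λ d / d * ((d : ℝ) ^ (-s) * (log x - log d)))
        = Λ d * (d : ℝ) ^ (-s) * (∑ m ∈ Ioc 0 (⌊x⌋₊ / d), (m.divisors.card : ℝ)
          - x / d * (log x - log d)) by ring]
    have hr : (d : ℝ) ^ (-s) ≤ 1 := rpow_le_one_of_one_le_of_nonpos hd1 (by linarith)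
    have hL : 0 ≤ Λ d := vonMangoldt_nonneg
    rw [abs_mul, abs_of_nonneg (by positivity)]
    calc Λ d * (d : ℝ) ^ (-s) * _ ≤ Λ d * 1 * (x / d) := by gcongr
      _ = x * (Λ d / d) := by ring
  refine (abs_sum_le_sum_abs _ _).trans ((sum_le_sum hterm).trans ?_)
  rw [← mul_sum]
  refine mul_le_mul_of_nonneg_left ?_ hx0.le
  have h := (abs_le.1 (abs_sum_vonMangoldt_div_sub_inv_le ⌊x⌋₊)).2
  rw [sum_sub_distrib, sum_inv_eq_harmonic] at h
  linarith [harmonic_floor_le_one_add_log x hx]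

lemma sum_vonMangoldt_convolution_eq (s : ℝ) (N : ℕ) :
    ∑ n ∈ Icc 1 N, ∑ d ∈ n.divisors, (-(Λ d) * (d : ℝ) ^ (-s)) * ((n / d).divisors.card : ℝ)
      = -∑ d ∈ Ioc 0 N, Λ d * (d : ℝ) ^ (-s) * ∑ m ∈ Ioc 0 (N / d), (m.divisors.card : ℝ) := by
  let F : ArithmeticFunction ℝ := ⟨fun d ↦ -(Λ d) * (d : ℝ) ^ (-s), by simp⟩
  let G : ArithmeticFunction ℝ := ⟨fun m ↦ (m.divisors.card : ℝ), by simp⟩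
  have h := sum_Ioc_mul_eq_sum_sum F G N
  simp only [mul_apply] at h
  rw [← sum_neg_distrib]
  convert h using 1
  · exact sum_congr (by ext; simp [Nat.succ_le_iff]) fun n _ ↦
      (Nat.sum_divisorsAntidiagonal (fun i j ↦ F i * G j)).symm
  · exact sum_congr rfl fun d _ ↦ by simp [F, G]

/-- Shifting the argument of `t ↦ e^{-t} - 1 + t` from `t` to `t + c`. -/
lemma abs_exp_neg_shift_le {t c : ℝ} (ht : 0 ≤ t) (hc : 0 ≤ c) :
    |(t - 1 + exp (-t)) - ((t + c) - 1 + exp (-(t + c)))| ≤ c * (t + c) := by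
  have h1 := add_one_le_exp (-c)
  have h2 := add_one_le_exp (-(t + c))
  have h3 := add_one_le_exp c
  have h4 : exp (-t) ≤ 1 := exp_le_one_iff.2 (by linarith)
  have h5 : exp (-(t + c)) = exp (-t) * exp (-c) := by rw [← exp_add]; ring_nf
  have h6 : exp (-t) = exp (-(t + c)) * exp c := by rw [← exp_add]; ring_nf
  have h7 : exp (-t) * (-c + 1) ≤ exp (-(t + c)) := by
    rw [h5]; exact mul_le_mul_of_nonneg_left h1 (exp_pos _).le
  have h8 : exp (-(t + c)) * (c + 1) ≤ exp (-t) := by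
    rw [h6]; exact mul_le_mul_of_nonneg_left h3 (exp_pos _).le
  rw [abs_le]
  constructor <;> nlinarith

end

/-- Mean value of `g(n) = ((-Λ(·)·^{-a/log T}) * τ)(n)`:
`Σ_{n ≤ T/2π} g(n) = (T (log T)²/2π) (1-a-e^{-a})/a² + O(T log T)` (unconditional). -/
theorem mean_value_g :
    ∃ C > (0:ℝ), ∃ δ > (0:ℝ), ∃ T₀ > (2:ℝ), ∀ T, T₀ ≤ T → ∀ a : ℝ,
      0 < a → a ≤ δ →
      |(∑ n ∈ Finset.Icc 1 ⌊T/(2*π)⌋₊, ∑ d ∈ n.divisors,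
            (-(ArithmeticFunction.vonMangoldt d) * (d : ℝ) ^ (-(a / Real.log T)))
              * ((n / d).divisors.card : ℝ))
          - T * Real.log T ^ 2 / (2*π) * ((1 - a - Real.exp (-a)) / a^2)|
        ≤ C * T * Real.log T := by
  have hc0 : 0 < log (2 * π) := log_pos (by linarith [pi_gt_three])
  have hlog4 : 0 < log 4 := log_pos (by norm_num)
  refine ⟨log (2 * π) + 2 * (log 4 + 6), by positivity, 1, one_pos, 7, by norm_num, ?_⟩
  intro T hT a ha _
  have hπ : 0 < 2 * π := by positivity
  have hT0 : 0 < T := by linarith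
  set x := T / (2 * π) with hx
  have hx1 : 1 ≤ x := (one_le_div hπ).2 (by linarith [pi_lt_d2])
  have hxT : x ≤ T := div_le_self hT0.le (by linarith [pi_gt_three])
  have hlT : 1 ≤ log T := (le_log_iff_exp_le hT0).2 (by linarith [exp_one_lt_d9])
  set s := a / log T with hs
  have hs0 : 0 < s := by positivity
  have hlx : log x = log T - log (2 * π) := log_div hT0.ne' hπ.ne'
  have hlx0 : 0 ≤ log x := log_nonneg hx1
  have hsT : s * log x + s * log (2 * π) = a := by
    rw [hlx, hs]; field_simp; ring
  have h1 := abs_sum_vonMangoldt_mul_divisors_sub_le hs0 hx1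
  have h2 := abs_sum_vonMangoldt_rpow_log_sub_le hs0 hx1
  have h3 := abs_exp_neg_shift_le (mul_nonneg hs0.le hlx0) (mul_nonneg hs0.le hc0.le)
  rw [hsT] at h3
  have h4 : |(s * log x - 1 + exp (-(s * log x))) / s ^ 2 - (a - 1 + exp (-a)) / s ^ 2|
      ≤ log (2 * π) * log T := by
    rw [← sub_div, abs_div, abs_of_pos (by positivity : 0 < s ^ 2), div_le_iff₀ (by positivity)]
    refine h3.trans (le_of_eq ?_)
    rw [hs]; field_simp
  have hmain : T * log T ^ 2 / (2 * π) * ((1 - a - exp (-a)) / a ^ 2)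
      = -(x * ((a - 1 + exp (-a)) / s ^ 2)) := by
    rw [hs, hx]; field_simp; ring
  rw [sum_vonMangoldt_convolution_eq, hmain]
  set D := ∑ d ∈ Finset.Ioc 0 ⌊x⌋₊, ArithmeticFunction.vonMangoldt d * (d : ℝ) ^ (-s) *
    ∑ m ∈ Finset.Ioc 0 (⌊x⌋₊ / d), (m.divisors.card : ℝ)
  set M := ∑ d ∈ Finset.Ioc 0 ⌊x⌋₊,
    ArithmeticFunction.vonMangoldt d / d * ((d : ℝ) ^ (-s) * (log x - log d))
  set K := (s * log x - 1 + exp (-(s * log x))) / s ^ 2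
  set K' := (a - 1 + exp (-a)) / s ^ 2
  have hx0 : 0 < x := by linarith
  have htri : |M - K'| ≤ (log 4 + 5) * log x + log (2 * π) * log T :=
    (abs_sub_le M K K').trans (add_le_add h2 h4)
  have hlxT : log x ≤ log T := by linarith
  have hMK : |x * (M - K')| ≤ x * ((log 4 + 5) * log T + log (2 * π) * log T) := by
    rw [abs_mul, abs_of_pos hx0]
    refine mul_le_mul_of_nonneg_left (htri.trans ?_) hx0.le
    gcongr
  calc |-D - -(x * K')| = |(D - x * M) + x * (M - K')| := by
        rw [← abs_neg]; ring_nf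
    _ ≤ x * (log x + (log 4 + 5)) + x * ((log 4 + 5) * log T + log (2 * π) * log T) :=
        (abs_add_le _ _).trans (add_le_add h1 hMK)
    _ ≤ x * (log T + (log 4 + 5) * log T) + x * ((log 4 + 5) * log T + log (2 * π) * log T) := by
        gcongr
        exact le_mul_of_one_le_right (by linarith) hlT
    _ ≤ x * ((log (2 * π) + 2 * (log 4 + 6)) * log T) := by
        rw [← mul_add]
        refine mul_le_mul_of_nonneg_left ?_ hx0.le
        linarith
    _ ≤ T * ((log (2 * π) + 2 * (log 4 + 6)) * log T) := by gcongr
    _ = (log (2 * π) + 2 * (log 4 + 6)) * T * log T := by ring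
end

section
/- For every real a > 0, one has (−a³ + 5a² − 10a − 10(e^{−a} − 1))/(2a³) < ((5a − 8) + 12e^{−a} − (a + 4)e^{−2a})/(4a³). -/
open Real

/-- A function vanishing at `0` whose derivative is positive on `(0, ∞)` is positive there. -/
theorem pos_of_hasDerivAt_pos {f f' : ℝ → ℝ} (hf : ∀ x, HasDerivAt f (f' x) x) (h0 : f 0 = 0)
    (hf' : ∀ x, 0 < x → 0 < f' x) (a : ℝ) (ha : 0 < a) : 0 < f a := by
  have hmono : StrictMonoOn f (Set.Ici 0) := by
    refine strictMonoOn_of_deriv_pos (convex_Ici 0)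
      (fun x _ => (hf x).continuousAt.continuousWithinAt) fun x hx => ?_
    rw [interior_Ici] at hx
    rw [(hf x).deriv]
    exact hf' x hx
  have h := hmono Set.self_mem_Ici ha.le ha
  rwa [h0] at h

theorem hasDerivAt_cubic (p q r s x : ℝ) :
    HasDerivAt (fun x : ℝ => p*x^3 - q*x^2 + r*x - s) (3*p*x^2 - 2*q*x + r) x := by
  refine HasDerivAt.congr_deriv ((((((hasDerivAt_id' x).pow 3).const_mul p).sub
    (((hasDerivAt_id' x).pow 2).const_mul q)).add ((hasDerivAt_id' x).const_mul r)).sub_const s) ?_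
  push_cast
  ring

theorem cubic_mul_exp_add_pos (a : ℝ) (ha : 0 < a) :
    0 < (8*a^3 - 16*a^2 + 32*a - 32) * Real.exp a + 32 := by
  refine pos_of_hasDerivAt_pos
    (f := fun x => (8*x^3 - 16*x^2 + 32*x - 32) * Real.exp x + 32)
    (f' := fun x => (8*x^3 + 8*x^2) * Real.exp x) (fun x => ?_) (by simp)
    (fun x hx => by positivity) a ha
  have hp : HasDerivAt (fun x : ℝ => 8*x^3 - 16*x^2 + 32*x - 32) (24*x^2 - 32*x + 32) x :=
    (hasDerivAt_cubic _ _ _ _ x).congr_deriv (by ring)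
  refine HasDerivAt.congr_deriv ((hp.mul (Real.hasDerivAt_exp x)).add_const 32) ?_
  ring

theorem cubic_mul_exp_sq_add_pos (a : ℝ) (ha : 0 < a) :
    0 < (4*a^3 - 14*a^2 + 30*a - 31) * Real.exp a ^ 2 + 32 * Real.exp a - 1 := by
  refine pos_of_hasDerivAt_pos
    (f := fun x => (4*x^3 - 14*x^2 + 30*x - 31) * Real.exp x ^ 2 + 32 * Real.exp x - 1)
    (f' := fun x => Real.exp x * ((8*x^3 - 16*x^2 + 32*x - 32) * Real.exp x + 32))
    (fun x => ?_) (by norm_num)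
    (fun x hx => mul_pos (Real.exp_pos x) (cubic_mul_exp_add_pos x hx)) a ha
  have hp : HasDerivAt (fun x : ℝ => 4*x^3 - 14*x^2 + 30*x - 31) (12*x^2 - 28*x + 30) x :=
    (hasDerivAt_cubic _ _ _ _ x).congr_deriv (by ring)
  refine HasDerivAt.congr_deriv (((hp.mul ((Real.hasDerivAt_exp x).pow 2)).add
    ((Real.hasDerivAt_exp x).const_mul 32)).sub_const 1) ?_
  simp only [Pi.pow_apply]
  push_cast
  ring

theorem cubic_mul_exp_sq_sub_pos (a : ℝ) (ha : 0 < a) :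
    0 < (2*a^3 - 10*a^2 + 25*a - 28) * Real.exp a ^ 2 + 32 * Real.exp a - (a + 4) := by
  refine pos_of_hasDerivAt_pos
    (f := fun x => (2*x^3 - 10*x^2 + 25*x - 28) * Real.exp x ^ 2 + 32 * Real.exp x - (x + 4))
    (f' := fun x => (4*x^3 - 14*x^2 + 30*x - 31) * Real.exp x ^ 2 + 32 * Real.exp x - 1)
    (fun x => ?_) (by norm_num) cubic_mul_exp_sq_add_pos a ha
  have hp : HasDerivAt (fun x : ℝ => 2*x^3 - 10*x^2 + 25*x - 28) (6*x^2 - 20*x + 25) x :=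
    (hasDerivAt_cubic _ _ _ _ x).congr_deriv (by ring)
  refine HasDerivAt.congr_deriv (((hp.mul ((Real.hasDerivAt_exp x).pow 2)).add
    ((Real.hasDerivAt_exp x).const_mul 32)).sub ((hasDerivAt_id' x).add_const 4)) ?_
  simp only [Pi.pow_apply]
  push_cast
  ring

/-- The lower-bound function `f₁` is strictly below the conjectured density `f`:
for all `a > 0`, `f₁(a) < f(a)`. -/
theorem f1_lt_f (a : ℝ) (ha : 0 < a) :
    (-a^3 + 5*a^2 - 10*a - 10*(Real.exp (-a) - 1)) / (2*a^3)
      < ((5*a - 8) + 12*Real.exp (-a) - (a + 4)*Real.exp (-2*a)) / (4*a^3) := by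
  have hpos := mul_pos (cubic_mul_exp_sq_sub_pos a ha) (pow_pos (Real.exp_pos (-a)) 2)
  have hmul : Real.exp a * Real.exp (-a) = 1 := by rw [← Real.exp_add]; simp
  have hsq : Real.exp (-2*a) = Real.exp (-a) ^ 2 := by
    rw [← Real.exp_nat_mul]
    congr 1
    push_cast
    ring
  have key : ((2*a^3 - 10*a^2 + 25*a - 28) * Real.exp a ^ 2 + 32 * Real.exp a - (a + 4))
      * Real.exp (-a) ^ 2
      = 2*a^3 - 10*a^2 + 25*a - 28 + 32 * Real.exp (-a) - (a + 4) * Real.exp (-a) ^ 2 := by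
    linear_combination ((2*a^3 - 10*a^2 + 25*a - 28) * (Real.exp a * Real.exp (-a) + 1)
      + 32 * Real.exp (-a)) * hmul
  rw [key] at hpos
  rw [hsq, div_lt_div_iff₀ (by positivity) (by positivity)]
  linear_combination 2 * a^3 * hpos
end
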